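/- Let n ≥ 1 and let 𝒯 = {K_1,…,K_q} be a triangle patch around z ∈ ℝ². Define c_n'(𝒯) := inf over nonzero v ∈ P_n(Ω) of ‖Π_n^𝒯 v‖²_𝒯 / ‖v‖²_𝒯, c_n''(𝒯) := inf over nonzero v ∈ P_n(Ω) of ‖v‖²_𝒯 / ‖v‖²_{L²(Ω)}, and ĉ_n(𝒯) := inf over nonzero v ∈ P_n(Ω) of (v, Π_n^𝒯 v)_𝒯 / ‖v‖²_{L²(Ω)}. Then c_n'(𝒯) > 0, c_n''(𝒯) > 0, and ĉ_n(𝒯) ≥ c_n''(𝒯) · c_n'(𝒯) > 0. -/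

import Mathlib

open MeasureTheory Finset

noncomputable section

/-- 2×2 determinant of two vectors in `ℝ²`. -/
def det2 (u v : ℝ × ℝ) : ℝ := u.1 * v.2 - u.2 * v.1

/-- The open triangle with vertices `A`, `B`, `C` (interior of the convex hull). -/
def tri (A B C : ℝ × ℝ) : Set (ℝ × ℝ) := interior (convexHull ℝ {A, B, C})

/-- Barycentric coordinate of `p` with respect to the vertex `A` of triangle `ABC`. -/
def bary (A B C p : ℝ × ℝ) : ℝ := det2 (p - B) (C - B) / det2 (A - B) (C - B)

/-- The cubic bubble: product of the three barycentric coordinates of triangle `ABC`. -/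
def bubble (A B C p : ℝ × ℝ) : ℝ := bary A B C p * bary B C A p * bary C A B p

/-- Evaluation of a bivariate polynomial at a point of `ℝ²`. -/
def evalP (u : MvPolynomial (Fin 2) ℝ) (p : ℝ × ℝ) : ℝ :=
  MvPolynomial.eval ![p.1, p.2] u

/-- The inner product `(u,v)_K := ∫_K u v ω_K` on the open triangle `K = conv°(A,B,C)`,
with weight the product of the barycentric coordinates. -/
def innerT (A B C : ℝ × ℝ) (u v : MvPolynomial (Fin 2) ℝ) : ℝ :=
  ∫ p in tri A B C, evalP u p * evalP v p * bubble A B C p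

/-- `u ∈ P_{n-1}^⊥(K)` for `K = conv°(A,B,C)`: `u` has total degree at most `n` and is
orthogonal to every polynomial of total degree at most `n-1` w.r.t. `(·,·)_K`. -/
def inPerp (n : ℕ) (A B C : ℝ × ℝ) (u : MvPolynomial (Fin 2) ℝ) : Prop :=
  u.totalDegree ≤ n ∧
    ∀ w : MvPolynomial (Fin 2) ℝ, w.totalDegree ≤ n - 1 → innerT A B C u w = 0

/-- A triangle patch around a point `z`: `q ≥ 3` pairwise disjoint nondegenerate open
triangles `K_i = conv°(z, A_{i-1}, A_i)` (indices cyclic, i.e. in `ZMod q`), consecutive ones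
sharing the edge from `z` to `A_i`, whose closed union covers a neighbourhood of `z`. -/
structure TrianglePatch (q : ℕ) where
  hq : 3 ≤ q
  z : ℝ × ℝ
  A : ZMod q → ℝ × ℝ
  indep : ∀ i : ZMod q, AffineIndependent ℝ ![z, A (i - 1), A i]
  disj : Pairwise fun i j : ZMod q =>
    Disjoint (tri z (A (i - 1)) (A i)) (tri z (A (j - 1)) (A j))
  covers : ∃ ε > 0, Metric.ball z ε ⊆ ⋃ i : ZMod q, closure (tri z (A (i - 1)) (A i))

/-- The `i`-th triangle of a patch. -/
def TrianglePatch.K {q : ℕ} (T : TrianglePatch q) (i : ZMod q) : Set (ℝ × ℝ) :=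
  tri T.z (T.A (i - 1)) (T.A i)

/-- `Ω`: the interior of the union of the closed triangles of the patch. -/
def TrianglePatch.Omega {q : ℕ} (T : TrianglePatch q) : Set (ℝ × ℝ) :=
  interior (⋃ i : ZMod q, closure (tri T.z (T.A (i - 1)) (T.A i)))

/-- The patch inner product `(u,v)_𝒯 = Σ_i (u_i, v_i)_{K_i}` of two piecewise polynomials
(given as tuples of polynomials, one for each triangle). -/
def patchInner {q : ℕ} (T : TrianglePatch q)
    (u v : ZMod q → MvPolynomial (Fin 2) ℝ) : ℝ :=
  haveI : NeZero q := ⟨by have := T.hq; omega⟩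
  ∑ i : ZMod q, innerT T.z (T.A (i - 1)) (T.A i) (u i) (v i)

/-- The set of Rayleigh quotients `‖Π_n^𝒯 v‖²_𝒯 / ‖v‖²_𝒯` over nonzero `v ∈ P_n(Ω)`;
its infimum is `c_n'(𝒯)`. -/
def cPrimeSet (n q : ℕ) (T : TrianglePatch q)
    (proj : (ZMod q → MvPolynomial (Fin 2) ℝ) → ZMod q → MvPolynomial (Fin 2) ℝ) :
    Set ℝ :=
  {r | ∃ v : MvPolynomial (Fin 2) ℝ, v ≠ 0 ∧ v.totalDegree ≤ n ∧
    r = patchInner T (proj fun _ => v) (proj fun _ => v) /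
        patchInner T (fun _ => v) (fun _ => v)}

/-- The set of quotients `‖v‖²_𝒯 / ‖v‖²_{L²(Ω)}` over nonzero `v ∈ P_n(Ω)`;
its infimum is `c_n''(𝒯)`. -/
def cDoubleSet (n q : ℕ) (T : TrianglePatch q) : Set ℝ :=
  {r | ∃ v : MvPolynomial (Fin 2) ℝ, v ≠ 0 ∧ v.totalDegree ≤ n ∧
    r = patchInner T (fun _ => v) (fun _ => v) / ∫ p in T.Omega, (evalP v p) ^ 2}

/-- The set of quotients `(v, Π_n^𝒯 v)_𝒯 / ‖v‖²_{L²(Ω)}` over nonzero `v ∈ P_n(Ω)`;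
its infimum is `ĉ_n(𝒯)`. -/
def cHatSet (n q : ℕ) (T : TrianglePatch q)
    (proj : (ZMod q → MvPolynomial (Fin 2) ℝ) → ZMod q → MvPolynomial (Fin 2) ℝ) :
    Set ℝ :=
  {r | ∃ v : MvPolynomial (Fin 2) ℝ, v ≠ 0 ∧ v.totalDegree ≤ n ∧
    r = patchInner T (fun _ => v) (proj fun _ => v) / ∫ p in T.Omega, (evalP v p) ^ 2}

/-- Integration of a real polynomial over the unit interval. -/
def unitIntegral : Polynomial ℝ →ₗ[ℝ] ℝ where
  toFun p := ∫ x in (0 : ℝ)..1, p.eval x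
  map_add' p r := by
    simp only [Polynomial.eval_add]
    exact intervalIntegral.integral_add (p.continuous.intervalIntegrable _ _)
      (r.continuous.intervalIntegrable _ _)
  map_smul' c p := by simp

lemma unitIntegral_apply (p : Polynomial ℝ) :
    unitIntegral p = ∫ x in (0 : ℝ)..1, p.eval x := rfl

lemma unitIntegral_derivative (p : Polynomial ℝ) :
    unitIntegral p.derivative = p.eval 1 - p.eval 0 :=
  intervalIntegral.integral_eq_sub_of_hasDerivAt (fun x _ => p.hasDerivAt x)
    (p.derivative.continuous.intervalIntegrable _ _)

lemma Polynomial.eq_zero_of_forall_mem_Ioo {p : Polynomial ℝ}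
    (h : ∀ x ∈ Set.Ioo (0 : ℝ) 1, p.eval x = 0) : p = 0 :=
  p.eq_zero_of_infinite_isRoot ((Set.Ioo_infinite one_pos).mono h)

lemma eq_zero_of_unitIntegral_eq_zero {p : Polynomial ℝ}
    (hp : ∀ x ∈ Set.Ioo (0 : ℝ) 1, 0 ≤ p.eval x) (h : unitIntegral p = 0) : p = 0 := by
  have h0 : ∀ x ∈ Set.Icc (0 : ℝ) 1, 0 ≤ p.eval x := by
    intro x hx
    rw [← closure_Ioo (zero_ne_one' ℝ)] at hx
    exact (isClosed_le continuous_const p.continuous).closure_subset_iff.2 hp hx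
  by_contra hne
  obtain ⟨x, hx, hxp⟩ : ∃ x ∈ Set.Ioo (0 : ℝ) 1, p.eval x ≠ 0 := by
    by_contra! hc
    exact hne (Polynomial.eq_zero_of_forall_mem_Ioo hc)
  have := intervalIntegral.integral_pos one_pos p.continuous.continuousOn
    (fun x hx => h0 x (Set.Ioc_subset_Icc_self hx))
    ⟨x, Set.Ioo_subset_Icc_self hx, (h0 x (Set.Ioo_subset_Icc_self hx)).lt_of_ne' hxp⟩
  rw [← unitIntegral_apply] at this
  exact this.ne' h

/-- Orthogonality to monomials of degree in `[a, b)` gives orthogonality to the polynomials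
spanned by them. -/
lemma unitIntegral_mul_eq_zero_of_monomials {F ω : Polynomial ℝ} {a b : ℕ}
    (h : ∀ l, a ≤ l → l < b → unitIntegral (F * Polynomial.X ^ l * ω) = 0)
    {p : Polynomial ℝ} (hp : p = 0 ∨ a + p.natDegree < b) :
    unitIntegral (F * (Polynomial.X ^ a * p) * ω) = 0 := by
  rcases hp with rfl | hp
  · simp
  conv_lhs => rw [p.as_sum_range]
  simp only [Finset.mul_sum, Finset.sum_mul, map_sum]
  refine Finset.sum_eq_zero fun i hi => ?_
  have hi' := Finset.mem_range.1 hi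
  have : F * (Polynomial.X ^ a * Polynomial.monomial i (p.coeff i)) * ω
      = p.coeff i • (F * Polynomial.X ^ (a + i) * ω) := by
    rw [← Polynomial.C_mul_X_pow_eq_monomial, Polynomial.smul_eq_C_mul]; ring
  rw [this, map_smul, h _ (by omega) (by omega), smul_zero]

/-- The Jacobi weight `r³ (1 - r)` of the radial variable. -/
def radialWeight : Polynomial ℝ := Polynomial.X ^ 3 * (1 - Polynomial.X)

lemma radialWeight_ne_zero : radialWeight ≠ 0 := by
  intro h
  have := congrArg (Polynomial.eval (1 / 2 : ℝ)) h
  norm_num [radialWeight] at this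

lemma radial_eq_zero_of_dvd {n k : ℕ} {F : Polynomial ℝ} (hdeg : F.natDegree ≤ n)
    (hdvd : Polynomial.X ^ (k + 1) ∣ F)
    (h : ∀ l, k ≤ l → l < n → unitIntegral (F * Polynomial.X ^ l * radialWeight) = 0) :
    F = 0 := by
  obtain ⟨g, rfl⟩ := hdvd
  by_cases hg : g = 0
  · simp [hg]
  rw [Polynomial.natDegree_mul (pow_ne_zero _ Polynomial.X_ne_zero) hg,
    Polynomial.natDegree_X_pow] at hdeg
  have h1 := unitIntegral_mul_eq_zero_of_monomials h (p := g) (Or.inr (by omega))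
  have h2 := eq_zero_of_unitIntegral_eq_zero (fun x hx => ?_) h1
  · simp [hg, radialWeight_ne_zero] at h2
  · have h3 : 0 ≤ 1 - x := by linarith [hx.2]
    have h4 := hx.1.le
    have : (Polynomial.X ^ (k + 1) * g * (Polynomial.X ^ k * g) * radialWeight).eval x
        = x ^ (2 * k + 4) * (1 - x) * (g.eval x) ^ 2 := by
      simp [radialWeight]; ring
    rw [this]; positivity

/-- A Jacobi polynomial has nonzero derivative at the origin. -/
lemma radial_eq_zero_of_derivative {n : ℕ} (hn : 1 ≤ n) {F : Polynomial ℝ}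
    (hdeg : F.natDegree ≤ n) (hd : F.derivative.eval 0 = 0)
    (h : ∀ l < n, unitIntegral (F * Polynomial.X ^ l * radialWeight) = 0) : F = 0 := by
  have h' : ∀ p : Polynomial ℝ, p.natDegree < n → unitIntegral (F * p * radialWeight) = 0 := by
    intro p hp
    have := unitIntegral_mul_eq_zero_of_monomials (a := 0) (fun l _ hl => h l hl)
      (p := p) (Or.inr (by omega))
    simpa using this
  have hd0 : F.derivative = 0 := by
    obtain ⟨g, hg⟩ := (Polynomial.X_dvd_iff (f := F.derivative)).2
      (by rwa [← Polynomial.coeff_zero_eq_eval_zero] at hd)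
    by_contra hne
    have hg0 : g ≠ 0 := fun h0 => hne (by rw [hg, h0, mul_zero])
    have hdg : g.natDegree + 2 ≤ n := by
      have h1 := Polynomial.natDegree_derivative_le F
      rw [hg, Polynomial.natDegree_X_mul hg0] at h1
      omega
    have hI := unitIntegral_derivative
      (F * (Polynomial.X ^ 4 * (1 - Polynomial.X) ^ 2 * g))
    have hbd : unitIntegral (F * ((4 - 6 * Polynomial.X) * g
        + Polynomial.X * (1 - Polynomial.X) * g.derivative) * radialWeight) = 0 := by
      apply h'
      have e1 : ((4 - 6 * Polynomial.X : Polynomial ℝ) * g).natDegree ≤ g.natDegree + 1 := by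
        refine Polynomial.natDegree_mul_le.trans ?_
        have : (4 - 6 * Polynomial.X : Polynomial ℝ).natDegree ≤ 1 := by compute_degree
        omega
      have e2 : (Polynomial.X * (1 - Polynomial.X) * g.derivative : Polynomial ℝ).natDegree
          ≤ g.natDegree + 1 := by
        by_cases hz : g.natDegree = 0
        · rw [Polynomial.eq_C_of_natDegree_eq_zero hz]; simp
        refine Polynomial.natDegree_mul_le.trans ?_
        have : (Polynomial.X * (1 - Polynomial.X) : Polynomial ℝ).natDegree ≤ 2 := by
          compute_degree
        have := Polynomial.natDegree_derivative_le g
        omega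
      have := Polynomial.natDegree_add_le_of_degree_le e1 e2
      omega
    have hder : Polynomial.derivative (F * (Polynomial.X ^ 4 * (1 - Polynomial.X) ^ 2 * g))
        = Polynomial.X ^ 5 * (1 - Polynomial.X) ^ 2 * g ^ 2 + F * ((4 - 6 * Polynomial.X) * g
        + Polynomial.X * (1 - Polynomial.X) * g.derivative) * radialWeight := by
      rw [Polynomial.derivative_mul, hg]
      simp only [radialWeight, Polynomial.derivative_mul, Polynomial.derivative_pow,
        Polynomial.derivative_sub, Polynomial.derivative_one,
        Polynomial.derivative_X]
      simp only [zero_sub, Nat.cast_ofNat, Polynomial.C_ofNat]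
      ring
    rw [hder, map_add, hbd] at hI
    have h2 := eq_zero_of_unitIntegral_eq_zero (fun x hx => ?_) (p :=
      Polynomial.X ^ 5 * (1 - Polynomial.X) ^ 2 * g ^ 2) (by simpa using hI)
    · have h3 : (1 - Polynomial.X : Polynomial ℝ) ≠ 0 := by
        intro h3
        have := congrArg (Polynomial.eval (0 : ℝ)) h3
        norm_num at this
      simp [hg0, h3] at h2
    · have := hx.1.le
      simp only [Polynomial.eval_mul, Polynomial.eval_pow, Polynomial.eval_X,
        Polynomial.eval_sub, Polynomial.eval_one]
      positivity
  obtain ⟨c, rfl⟩ : ∃ c, F = Polynomial.C c :=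
    ⟨_, Polynomial.eq_C_of_natDegree_eq_zero (Polynomial.derivative_eq_zero.1 hd0)⟩
  by_contra hc
  have h1 := h' (Polynomial.C c) (by simp; omega)
  have h2 := eq_zero_of_unitIntegral_eq_zero (fun x hx => ?_) h1
  · simp only [mul_eq_zero, radialWeight_ne_zero, or_false, or_self] at h2
    exact hc h2
  · have h3 : 0 ≤ 1 - x := by linarith [hx.2]
    have h4 := hx.1.le
    have : (Polynomial.C c * Polynomial.C c * radialWeight).eval x
        = x ^ 3 * (1 - x) * c ^ 2 := by
      simp [radialWeight]; ring
    rw [this]; positivity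

/-- Every nonzero real polynomial becomes of constant sign on `(0,1)` after multiplication by
simple factors at some of its roots in `(0,1)`. -/
lemma exists_roots_mul_prod_constant_sign (f : Polynomial ℝ) (hf : f ≠ 0) :
    ∃ R : Finset ℝ, (∀ r ∈ R, r ∈ Set.Ioo (0 : ℝ) 1 ∧ f.eval r = 0) ∧
      ((∀ x ∈ Set.Ioo (0 : ℝ) 1,
        0 ≤ (f * ∏ r ∈ R, (Polynomial.X - Polynomial.C r)).eval x) ∨
      (∀ x ∈ Set.Ioo (0 : ℝ) 1,
        (f * ∏ r ∈ R, (Polynomial.X - Polynomial.C r)).eval x ≤ 0)) := by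
  induction hd : f.natDegree using Nat.strong_induction_on generalizing f with
  | _ d ih =>
  by_cases hroot : ∃ r ∈ Set.Ioo (0 : ℝ) 1, f.eval r = 0
  · obtain ⟨r, hr, hfr⟩ := hroot
    obtain ⟨g, rfl⟩ := Polynomial.dvd_iff_isRoot.2 hfr
    have hg : g ≠ 0 := right_ne_zero_of_mul hf
    have hdeg := Polynomial.natDegree_mul (Polynomial.X_sub_C_ne_zero r) hg
    rw [Polynomial.natDegree_X_sub_C] at hdeg
    obtain ⟨R, hR, hs⟩ := ih _ (by omega) g hg rfl
    by_cases hrR : r ∈ R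
    · refine ⟨R.erase r, fun s hs => ?_, ?_⟩
      · have := hR s (Finset.mem_of_mem_erase hs)
        exact ⟨this.1, by simp [this.2]⟩
      · rwa [mul_comm _ g, mul_assoc, Finset.mul_prod_erase R
          (fun r => Polynomial.X - Polynomial.C r) hrR]
    · refine ⟨insert r R, fun s hs => ?_, ?_⟩
      · rcases Finset.mem_insert.1 hs with rfl | hs
        · exact ⟨hr, hfr⟩
        · have := hR s hs
          exact ⟨this.1, by simp [this.2]⟩
      · rw [Finset.prod_insert hrR]
        have key : ∀ x, ((Polynomial.X - Polynomial.C r) * g * ((Polynomial.X - Polynomial.C r) *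
            ∏ r ∈ R, (Polynomial.X - Polynomial.C r))).eval x
            = (x - r) ^ 2 * (g * ∏ r ∈ R, (Polynomial.X - Polynomial.C r)).eval x := by
          intro x
          simp only [Polynomial.eval_mul, Polynomial.eval_sub, Polynomial.eval_X,
            Polynomial.eval_C]
          ring
        simp only [key]
        exact hs.imp (fun h x hx => mul_nonneg (sq_nonneg _) (h x hx))
          (fun h x hx => mul_nonpos_of_nonneg_of_nonpos (sq_nonneg _) (h x hx))
  · push Not at hroot
    refine ⟨∅, by simp, ?_⟩
    simp only [Finset.prod_empty, mul_one]
    by_contra! hcon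
    obtain ⟨⟨x, hx, hx'⟩, y, hy, hy'⟩ := hcon
    obtain ⟨w, hw, hw'⟩ := isPreconnected_Ioo.intermediate_value hx hy
      f.continuous.continuousOn ⟨hx'.le, hy'.le⟩
    exact hroot w hw hw'

/-- A polynomial orthogonal on `(0,1)` with weight `s (1 - s)` to all polynomials of degree
less than `k` has at least `k` roots in `(0,1)`. -/
lemma exists_roots_of_orthogonal {k : ℕ} {f : Polynomial ℝ}
    (h : ∀ i < k, unitIntegral (f * Polynomial.X ^ i *
      (Polynomial.X * (1 - Polynomial.X))) = 0) :
    ∃ R : Finset ℝ, R.card = k ∧ ∀ r ∈ R, r ∈ Set.Ioo (0 : ℝ) 1 ∧ f.eval r = 0 := by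
  by_cases hf : f = 0
  · obtain ⟨R, hR, hc⟩ := (Set.Ioo_infinite (zero_lt_one' ℝ)).exists_subset_card_eq k
    exact ⟨R, hc, fun r hr => ⟨hR hr, by simp [hf]⟩⟩
  obtain ⟨R, hR, hs⟩ := exists_roots_mul_prod_constant_sign f hf
  rcases le_or_gt k R.card with hk | hk
  · obtain ⟨R', hR', hc⟩ := Finset.exists_subset_card_eq hk
    exact ⟨R', hc, fun r hr => hR r (hR' hr)⟩
  exfalso
  set g : Polynomial ℝ := ∏ r ∈ R, (Polynomial.X - Polynomial.C r) with hg
  have hmonic : g.Monic := Polynomial.monic_prod_of_monic _ _ fun r _ => Polynomial.monic_X_sub_C r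
  have hgd : g.natDegree = R.card := by
    rw [hg, Polynomial.natDegree_prod_of_monic _ _ fun r _ => Polynomial.monic_X_sub_C r]
    simp
  have h1 := unitIntegral_mul_eq_zero_of_monomials (a := 0) (fun l _ hl => h l hl)
      (p := g) (Or.inr (by omega))
  rw [pow_zero, one_mul] at h1
  have h3 : (1 - Polynomial.X : Polynomial ℝ) ≠ 0 := by
    intro h3
    have := congrArg (Polynomial.eval (0 : ℝ)) h3
    norm_num at this
  have hne : f * g * (Polynomial.X * (1 - Polynomial.X)) ≠ 0 := by
    simp [hf, hmonic.ne_zero, h3]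
  have hw : ∀ x ∈ Set.Ioo (0 : ℝ) 1, 0 ≤ x * (1 - x) := fun x hx =>
    mul_nonneg hx.1.le (by linarith [hx.2])
  rcases hs with hs | hs
  · refine hne (eq_zero_of_unitIntegral_eq_zero (fun x hx => ?_) h1)
    have := mul_nonneg (hs x hx) (hw x hx)
    rw [Polynomial.eval_mul]
    simpa using this
  · refine hne (neg_eq_zero.1 (eq_zero_of_unitIntegral_eq_zero (fun x hx => ?_)
      (by rw [map_neg, h1, neg_zero])))
    have := mul_nonpos_of_nonpos_of_nonneg (hs x hx) (hw x hx)
    rw [Polynomial.eval_neg, Polynomial.eval_mul]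
    simpa using this

lemma evalP_add (u v : MvPolynomial (Fin 2) ℝ) (p : ℝ × ℝ) :
    evalP (u + v) p = evalP u p + evalP v p := by simp [evalP]

lemma evalP_smul (c : ℝ) (u : MvPolynomial (Fin 2) ℝ) (p : ℝ × ℝ) :
    evalP (c • u) p = c * evalP u p := by simp [evalP]

lemma continuous_evalP (u : MvPolynomial (Fin 2) ℝ) : Continuous (evalP u) := by
  unfold evalP
  refine (MvPolynomial.continuous_eval u).comp ?_
  refine continuous_pi fun i => ?_
  fin_cases i
  · exact continuous_fst
  · exact continuous_snd

lemma eq_zero_of_evalP_eq_zero_on_open {u : MvPolynomial (Fin 2) ℝ} {U : Set (ℝ × ℝ)}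
    (hU : IsOpen U) (hne : U.Nonempty) (h : ∀ p ∈ U, evalP u p = 0) : u = 0 := by
  obtain ⟨⟨x, y⟩, hp⟩ := hne
  obtain ⟨V, W, hV, hW, hx, hy, hVW⟩ := isOpen_prod_iff.1 hU x y hp
  refine MvPolynomial.funext_set ![V, W] (fun i => ?_) fun a ha => ?_
  · fin_cases i
    · exact infinite_of_mem_nhds x (hV.mem_nhds hx)
    · exact infinite_of_mem_nhds y (hW.mem_nhds hy)
  · have h0 : a 0 ∈ V := ha 0 (Set.mem_univ _)
    have h1 : a 1 ∈ W := ha 1 (Set.mem_univ _)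
    have := h (a 0, a 1) (hVW ⟨h0, h1⟩)
    have ha' : ![a 0, a 1] = a := by
      ext i
      fin_cases i <;> rfl
    rw [map_zero, ← this, evalP, ha']

lemma MvPolynomial.IsHomogeneous.evalP_smul {H : MvPolynomial (Fin 2) ℝ} {k : ℕ}
    (hH : H.IsHomogeneous k) (t : ℝ) (p : ℝ × ℝ) : evalP H (t • p) = t ^ k * evalP H p := by
  simp only [evalP, MvPolynomial.eval_eq', Fin.prod_univ_two, Finset.mul_sum]
  refine Finset.sum_congr rfl fun d hd => ?_
  have : d 0 + d 1 = k := by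
    rw [hH.degree_eq_sum_deg_support hd, ← Finsupp.degree_apply,
      Finsupp.degree_eq_sum, Fin.sum_univ_two]
  simp only [Prod.smul_fst, Prod.smul_snd, smul_eq_mul, Matrix.cons_val_zero,
    Matrix.cons_val_one, mul_pow, ← this, pow_add]
  ring

/-- A univariate polynomial obtained by restricting a bivariate one to a line. -/
def restrictLine (H : MvPolynomial (Fin 2) ℝ) (a b : ℝ × ℝ) : Polynomial ℝ :=
  MvPolynomial.aeval ![Polynomial.C b.1 * Polynomial.X + Polynomial.C a.1,
    Polynomial.C b.2 * Polynomial.X + Polynomial.C a.2] H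

lemma eval_restrictLine (H : MvPolynomial (Fin 2) ℝ) (a b : ℝ × ℝ) (t : ℝ) :
    (restrictLine H a b).eval t = evalP H (a + t • b) := by
  have : (Polynomial.evalRingHom t).comp (MvPolynomial.aeval (R := ℝ)
      ![Polynomial.C b.1 * Polynomial.X + Polynomial.C a.1,
        Polynomial.C b.2 * Polynomial.X + Polynomial.C a.2]).toRingHom
      = MvPolynomial.eval ![(a + t • b).1, (a + t • b).2] := by
    apply MvPolynomial.ringHom_ext
    · intro r; simp
    · intro i
      fin_cases i <;> simp <;> ring
  exact congrArg (fun φ => φ H) this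

lemma natDegree_restrictLine_le {H : MvPolynomial (Fin 2) ℝ} {k : ℕ} (hH : H.totalDegree ≤ k)
    (a b : ℝ × ℝ) : (restrictLine H a b).natDegree ≤ k := by
  have := MvPolynomial.aeval_natDegree_le H hH
    ![Polynomial.C b.1 * Polynomial.X + Polynomial.C a.1,
      Polynomial.C b.2 * Polynomial.X + Polynomial.C a.2] (n := 1) (by
        intro i
        fin_cases i
        · exact Polynomial.natDegree_linear_le
        · exact Polynomial.natDegree_linear_le)
  simpa [restrictLine] using this

/-- A homogeneous polynomial of degree `k` vanishing on more than `2 * k` distinct rays is zero. -/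
lemma MvPolynomial.IsHomogeneous.eq_zero_of_rays {α : Type*} {H : MvPolynomial (Fin 2) ℝ} {k : ℕ}
    (hH : H.IsHomogeneous k) (P : Finset α) (f : α → ℝ × ℝ) (h0 : ∀ x ∈ P, f x ≠ 0)
    (hray : ∀ x ∈ P, ∀ y ∈ P, ∀ t : ℝ, 0 < t → f x = t • f y → x = y)
    (hzero : ∀ x ∈ P, evalP H (f x) = 0) (hcard : 2 * k < P.card) : H = 0 := by
  classical
  obtain ⟨m, hm⟩ := Infinite.exists_notMem_finset (P.image fun x => (f x).2 / (f x).1)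
  set c : ℝ × ℝ → ℝ := fun p => p.2 - m * p.1 with hc
  have hcP : ∀ x ∈ P, c (f x) ≠ 0 := by
    intro x hx hcx
    have h2 : (f x).2 = m * (f x).1 := sub_eq_zero.1 hcx
    by_cases h1 : (f x).1 = 0
    · exact h0 x hx (Prod.ext h1 (by simp [h2, h1]))
    · exact hm (Finset.mem_image.2 ⟨x, hx, by rw [h2]; field_simp⟩)
  have hdecomp : ∀ p : ℝ × ℝ, c p ≠ 0 →
      p = c p • (((0 : ℝ), (1 : ℝ)) + (p.1 / c p) • ((1 : ℝ), m)) := by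
    intro p hp
    ext
    · simp; field_simp
    · simp; field_simp; simp [hc]; ring
  set Q := restrictLine H (0, 1) (1, m) with hQ
  have hHQ : ∀ p : ℝ × ℝ, c p ≠ 0 → evalP H p = c p ^ k * Q.eval (p.1 / c p) := by
    intro p hp
    rw [hQ, eval_restrictLine, ← hH.evalP_smul, ← hdecomp p hp]
  have hhalf : ∀ S ⊆ P, k < S.card → (∀ x ∈ S, ∀ y ∈ S, 0 < c (f x) / c (f y)) → Q = 0 := by
    intro S hS hk hsign
    have hinj : Set.InjOn (fun x => (f x).1 / c (f x)) S := by
      intro x hx y hy hxy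
      refine hray x (hS hx) y (hS hy) (c (f x) / c (f y)) (hsign x hx y hy) ?_
      have hcx := hcP x (hS hx)
      have hcy := hcP y (hS hy)
      simp only at hxy
      calc f x = c (f x) • (((0 : ℝ), (1 : ℝ)) + ((f y).1 / c (f y)) • ((1 : ℝ), m)) := by
            rw [← hxy]; exact hdecomp _ hcx
        _ = (c (f x) / c (f y)) •
            (c (f y) • (((0 : ℝ), (1 : ℝ)) + ((f y).1 / c (f y)) • ((1 : ℝ), m))) := by
            rw [smul_smul, div_mul_cancel₀ _ hcy]
        _ = (c (f x) / c (f y)) • f y := by rw [← hdecomp _ hcy]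
    refine Polynomial.eq_zero_of_natDegree_lt_card_of_eval_eq_zero' Q
      (S.image fun x => (f x).1 / c (f x)) ?_ ?_
    · intro t ht
      obtain ⟨x, hx, rfl⟩ := Finset.mem_image.1 ht
      have h1 := hHQ _ (hcP x (hS hx))
      rw [hzero x (hS hx), eq_comm, mul_eq_zero] at h1
      exact h1.resolve_left (pow_ne_zero _ (hcP x (hS hx)))
    · rw [Finset.card_image_of_injOn hinj]
      exact (natDegree_restrictLine_le hH.totalDegree_le _ _).trans_lt hk
  have hQ0 : Q = 0 := by
    have hsplit := Finset.card_filter_add_card_filter_not (s := P) (fun x => 0 < c (f x))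
    rcases lt_or_ge k (P.filter fun x => 0 < c (f x)).card with h | h
    · refine hhalf _ (Finset.filter_subset _ _) h fun x hx y hy => ?_
      exact div_pos (Finset.mem_filter.1 hx).2 (Finset.mem_filter.1 hy).2
    · refine hhalf (P.filter fun x => ¬ 0 < c (f x)) (Finset.filter_subset _ _) (by omega)
        fun x hx y hy => ?_
      have hx' := Finset.mem_filter.1 hx
      have hy' := Finset.mem_filter.1 hy
      exact div_pos_of_neg_of_neg ((not_lt.1 hx'.2).lt_of_ne (hcP x hx'.1))
        ((not_lt.1 hy'.2).lt_of_ne (hcP y hy'.1))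
  refine eq_zero_of_evalP_eq_zero_on_open (U := {p | c p ≠ 0})
    (isOpen_ne_fun (by fun_prop) continuous_const) ⟨(0, 1), by simp [hc]⟩ fun p hp => ?_
  rw [hHQ p hp, hQ0]
  simp

/-- The Taylor expansion polynomial of `v` at `z`. -/
def shiftP (z : ℝ × ℝ) (v : MvPolynomial (Fin 2) ℝ) : MvPolynomial (Fin 2) ℝ :=
  MvPolynomial.aeval ![MvPolynomial.X 0 + MvPolynomial.C z.1,
    MvPolynomial.X 1 + MvPolynomial.C z.2] v

lemma evalP_shiftP (z : ℝ × ℝ) (v : MvPolynomial (Fin 2) ℝ) (p : ℝ × ℝ) :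
    evalP (shiftP z v) p = evalP v (z + p) := by
  have : (MvPolynomial.eval ![p.1, p.2]).comp (MvPolynomial.aeval (R := ℝ)
      ![(MvPolynomial.X 0 + MvPolynomial.C z.1 : MvPolynomial (Fin 2) ℝ),
        MvPolynomial.X 1 + MvPolynomial.C z.2]).toRingHom
      = MvPolynomial.eval ![(z + p).1, (z + p).2] := by
    apply MvPolynomial.ringHom_ext
    · intro r; simp
    · intro i
      fin_cases i <;> simp [add_comm]
  exact congrArg (fun φ => φ v) this

lemma totalDegree_shiftP_le (z : ℝ × ℝ) (v : MvPolynomial (Fin 2) ℝ) :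
    (shiftP z v).totalDegree ≤ v.totalDegree := by
  rw [shiftP, MvPolynomial.aeval_def, MvPolynomial.eval₂_eq']
  refine MvPolynomial.totalDegree_finsetSum_le fun d hd => ?_
  rw [Fin.prod_univ_two]
  have hlin : ∀ (i : Fin 2) (c : ℝ),
      (MvPolynomial.X i + MvPolynomial.C c : MvPolynomial (Fin 2) ℝ).totalDegree ≤ 1 :=
    fun i c => (MvPolynomial.totalDegree_add _ _).trans (by simp)
  have hpow : ∀ (i : Fin 2) (c : ℝ) (e : ℕ),
      ((MvPolynomial.X i + MvPolynomial.C c : MvPolynomial (Fin 2) ℝ) ^ e).totalDegree ≤ e :=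
    fun i c e => (MvPolynomial.totalDegree_pow _ _).trans
      ((Nat.mul_le_mul_left e (hlin i c)).trans (mul_one e).le)
  have hd' : d 0 + d 1 ≤ v.totalDegree := by
    have := MvPolynomial.le_totalDegree hd
    rwa [Finsupp.sum_fintype _ _ fun _ => rfl, Fin.sum_univ_two] at this
  refine (MvPolynomial.totalDegree_mul _ _).trans ?_
  have h1 := (MvPolynomial.totalDegree_mul
    ((MvPolynomial.X 0 + MvPolynomial.C z.1 : MvPolynomial (Fin 2) ℝ) ^ d 0)
    ((MvPolynomial.X 1 + MvPolynomial.C z.2) ^ d 1)).trans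
    (add_le_add (hpow 0 z.1 (d 0)) (hpow 1 z.2 (d 1)))
  have h2 : (algebraMap ℝ (MvPolynomial (Fin 2) ℝ) (v.coeff d)).totalDegree = 0 := by
    rw [MvPolynomial.algebraMap_eq, MvPolynomial.totalDegree_C]
  simp only [Matrix.cons_val_zero, Matrix.cons_val_one]
  omega

/-- The homogeneous part of degree `j` of `v` around `z`. -/
def homPart (z : ℝ × ℝ) (j : ℕ) (v : MvPolynomial (Fin 2) ℝ) : MvPolynomial (Fin 2) ℝ :=
  MvPolynomial.homogeneousComponent j (shiftP z v)

lemma homPart_isHomogeneous (z : ℝ × ℝ) (j : ℕ) (v : MvPolynomial (Fin 2) ℝ) :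
    (homPart z j v).IsHomogeneous j :=
  MvPolynomial.homogeneousComponent_isHomogeneous _ _

lemma sum_homPart {n : ℕ} (z : ℝ × ℝ) {v : MvPolynomial (Fin 2) ℝ} (hv : v.totalDegree ≤ n) :
    ∑ j ∈ Finset.range (n + 1), homPart z j v = shiftP z v := by
  conv_rhs => rw [← MvPolynomial.sum_homogeneousComponent (shiftP z v)]
  have h := (totalDegree_shiftP_le z v).trans hv
  symm
  refine Finset.sum_subset (Finset.range_mono (by omega)) fun j _ hj => ?_
  exact MvPolynomial.homogeneousComponent_eq_zero _ _ (by simp at hj; omega)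

lemma evalP_add_smul {n : ℕ} (z : ℝ × ℝ) {v : MvPolynomial (Fin 2) ℝ} (hv : v.totalDegree ≤ n)
    (r : ℝ) (p : ℝ × ℝ) :
    evalP v (z + r • p) = ∑ j ∈ Finset.range (n + 1), r ^ j * evalP (homPart z j v) p := by
  rw [← evalP_shiftP, ← sum_homPart z hv]
  conv_lhs => rw [evalP, map_sum]
  exact Finset.sum_congr rfl fun j _ => (homPart_isHomogeneous z j v).evalP_smul r p

lemma eq_zero_of_homPart_eq_zero {n : ℕ} {z : ℝ × ℝ} {v : MvPolynomial (Fin 2) ℝ}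
    (hv : v.totalDegree ≤ n) (h : ∀ j ≤ n, homPart z j v = 0) : v = 0 := by
  refine eq_zero_of_evalP_eq_zero_on_open isOpen_univ Set.univ_nonempty fun p _ => ?_
  have := evalP_add_smul z hv 1 (p - z)
  rw [one_smul, add_sub_cancel] at this
  rw [this]
  refine Finset.sum_eq_zero fun j hj => ?_
  rw [h j (by simp at hj; omega)]
  simp [evalP]

lemma det2_ne_zero_of_affineIndependent {z A B : ℝ × ℝ}
    (h : AffineIndependent ℝ ![z, A, B]) : det2 (A - z) (B - z) ≠ 0 := by
  rw [affineIndependent_iff_linearIndependent_vsub ℝ _ (0 : Fin 3)] at h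
  have h2 : LinearIndependent ℝ ![A - z, B - z] := by
    have := h.comp (fun i : Fin 2 => (⟨i.succ, Fin.succ_ne_zero i⟩ : {x : Fin 3 // x ≠ 0}))
      (fun i j hij => by simpa using hij)
    have e : (fun i : {x : Fin 3 // x ≠ 0} => ![z, A, B] i -ᵥ ![z, A, B] 0) ∘
        (fun i : Fin 2 => (⟨i.succ, Fin.succ_ne_zero i⟩ : {x : Fin 3 // x ≠ 0}))
        = ![A - z, B - z] := by
      funext i
      fin_cases i <;> rfl
    rwa [e] at this
  rw [LinearIndependent.pair_iff] at h2
  intro hD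
  simp only [det2] at hD
  have e1 := h2 (B - z).2 (-(A - z).2) (by ext <;> simp at hD ⊢ <;> linarith)
  have e2 := h2 (B - z).1 (-(A - z).1) (by ext <;> simp at hD ⊢ <;> linarith)
  have := h2 1 0 (by
    ext
    · simpa using neg_eq_zero.1 e2.2
    · simpa using neg_eq_zero.1 e1.2)
  exact one_ne_zero this.1

lemma mem_tri_iff {z A B : ℝ × ℝ} (h : AffineIndependent ℝ ![z, A, B]) (p : ℝ × ℝ) :
    p ∈ tri z A B ↔ ∃ β γ : ℝ, 0 < β ∧ 0 < γ ∧ β + γ < 1 ∧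
      p = z + (β • (A - z) + γ • (B - z)) := by
  have htop : affineSpan ℝ (Set.range ![z, A, B]) = ⊤ :=
    h.affineSpan_eq_top_iff_card_eq_finrank_add_one.2 (by simp)
  let b : AffineBasis (Fin 3) ℝ (ℝ × ℝ) := ⟨![z, A, B], h, htop⟩
  have hrange : Set.range b = {z, A, B} := by
    have : Set.range ![z, A, B] = {z, A, B} := by
      ext x; simp [eq_comm]; tauto
    exact this
  have hb0 : b 0 = z := rfl
  have hb1 : b 1 = A := rfl
  have hb2 : b 2 = B := rfl
  rw [tri, ← hrange, b.interior_convexHull]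
  constructor
  · intro hp
    have hs := b.sum_coord_apply_eq_one p
    have hc := b.linear_combination_coord_eq_self p
    rw [Fin.sum_univ_three] at hs hc
    rw [hb0, hb1, hb2] at hc
    have h0 : 0 < b.coord 0 p := hp 0
    refine ⟨b.coord 1 p, b.coord 2 p, hp 1, hp 2, by linarith, ?_⟩
    have e : b.coord 0 p = 1 - b.coord 1 p - b.coord 2 p := by linarith
    conv_lhs => rw [← hc, e]
    module
  · rintro ⟨β, γ, hβ, hγ, hs, rfl⟩
    have key : z + (β • (A - z) + γ • (B - z))
        = Finset.univ.affineCombination ℝ b ![1 - β - γ, β, γ] := by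
      rw [Finset.affineCombination_eq_linear_combination _ _ _ (by
        rw [Fin.sum_univ_three]; simp; ring)]
      rw [Fin.sum_univ_three, hb0, hb1, hb2]
      simp only [Matrix.cons_val]
      module
    intro i
    rw [key, b.coord_apply_combination_of_mem (Finset.mem_univ i) (by
        rw [Fin.sum_univ_three]; simp; ring)]
    fin_cases i
    · simp; linarith
    · simpa
    · simpa

lemma bubble_eq {z A B : ℝ × ℝ} (h : det2 (A - z) (B - z) ≠ 0) (β γ : ℝ) :
    bubble z A B (z + (β • (A - z) + γ • (B - z))) = (1 - β - γ) * β * γ := by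
  have h1 : det2 (z - A) (B - A) = -det2 (A - z) (B - z) := by simp [det2]; ring
  have h2 : det2 (A - B) (z - B) = -det2 (A - z) (B - z) := by simp [det2]; ring
  have h3 : det2 (B - z) (A - z) = -det2 (A - z) (B - z) := by simp [det2]; ring
  have e1 : det2 (z + (β • (A - z) + γ • (B - z)) - A) (B - A)
      = -((1 - β - γ) * det2 (A - z) (B - z)) := by simp [det2]; ring
  have e2 : det2 (z + (β • (A - z) + γ • (B - z)) - B) (z - B)
      = -(β * det2 (A - z) (B - z)) := by simp [det2]; ring
  have e3 : det2 (z + (β • (A - z) + γ • (B - z)) - z) (A - z)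
      = -(γ * det2 (A - z) (B - z)) := by simp [det2]; ring
  simp only [bubble, bary, h1, h2, h3, e1, e2, e3, neg_div_neg_eq, mul_div_assoc, div_self h,
    mul_one]

lemma continuous_bubble (A B C : ℝ × ℝ) : Continuous (bubble A B C) := by
  unfold bubble bary det2
  fun_prop

lemma isOpen_tri (A B C : ℝ × ℝ) : IsOpen (tri A B C) := isOpen_interior

lemma isCompact_convexHull_triple (A B C : ℝ × ℝ) :
    IsCompact (convexHull ℝ ({A, B, C} : Set (ℝ × ℝ))) :=
  (Set.toFinite _).isCompact_convexHull ℝ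

lemma closure_tri_subset (A B C : ℝ × ℝ) :
    closure (tri A B C) ⊆ convexHull ℝ {A, B, C} :=
  closure_minimal interior_subset (isCompact_convexHull_triple A B C).isClosed

lemma Continuous.integrableOn_tri {f : ℝ × ℝ → ℝ} (hf : Continuous f) (A B C : ℝ × ℝ) :
    IntegrableOn f (tri A B C) :=
  (hf.continuousOn.integrableOn_compact (isCompact_convexHull_triple A B C)).mono_set
    interior_subset

lemma integrableOn_innerT (A B C : ℝ × ℝ) (u v : MvPolynomial (Fin 2) ℝ) :
    IntegrableOn (fun p => evalP u p * evalP v p * bubble A B C p) (tri A B C) :=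
  (((continuous_evalP u).mul (continuous_evalP v)).mul
    (continuous_bubble A B C)).integrableOn_tri A B C

/-- The map collapsing the unit square onto the triangle with vertices `z`, `z + a`, `z + b`. -/
def duffy (z a b : ℝ × ℝ) (x : ℝ × ℝ) : ℝ × ℝ := z + x.1 • (b + x.2 • (a - b))

/-- The derivative of the map `duffy`. -/
def duffyDeriv (a b x : ℝ × ℝ) : ℝ × ℝ →L[ℝ] ℝ × ℝ :=
  (Matrix.toLin (.finTwoProd ℝ) (.finTwoProd ℝ)
    !![b.1 + x.2 * (a.1 - b.1), x.1 * (a.1 - b.1);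
       b.2 + x.2 * (a.2 - b.2), x.1 * (a.2 - b.2)]).toContinuousLinearMap

lemma hasFDerivAt_duffy (z a b x : ℝ × ℝ) :
    HasFDerivAt (duffy z a b) (duffyDeriv a b x) x := by
  unfold duffyDeriv
  rw [Matrix.toLin_finTwoProd_toContinuousLinearMap]
  have h : ∀ c d e : ℝ, HasFDerivAt (fun x : ℝ × ℝ => e + x.1 * (c + x.2 * d))
      ((c + x.2 * d) • ContinuousLinearMap.fst ℝ ℝ ℝ
        + (x.1 * d) • ContinuousLinearMap.snd ℝ ℝ ℝ) x := by
    intro c d e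
    have h1 := (hasFDerivAt_fst (𝕜 := ℝ) (p := x)).mul
      (((hasFDerivAt_snd (𝕜 := ℝ) (p := x)).mul_const d).const_add c)
    convert! h1.const_add e using 1
    ext <;> simp
  exact (h b.1 (a.1 - b.1) z.1).prodMk (h b.2 (a.2 - b.2) z.2)

lemma det_duffyDeriv (a b x : ℝ × ℝ) : (duffyDeriv a b x).det = -(x.1 * det2 a b) := by
  unfold duffyDeriv
  simp only [LinearMap.det_toContinuousLinearMap, LinearMap.det_toLin, Matrix.det_fin_two_of, det2]
  ring

lemma duffy_image {z A B : ℝ × ℝ} (h : AffineIndependent ℝ ![z, A, B]) :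
    duffy z (A - z) (B - z) '' (Set.Ioo 0 1 ×ˢ Set.Ioo 0 1) = tri z A B := by
  ext p
  rw [mem_tri_iff h]
  constructor
  · rintro ⟨⟨r, s⟩, ⟨⟨hr0, hr1⟩, hs0, hs1⟩, rfl⟩
    simp only at hr0 hr1 hs0 hs1
    refine ⟨r * s, r * (1 - s), mul_pos hr0 hs0, mul_pos hr0 (by linarith), by linarith, ?_⟩
    simp only [duffy]
    module
  · rintro ⟨β, γ, hβ, hγ, hs, rfl⟩
    have hp : 0 < β + γ := add_pos hβ hγ
    refine ⟨(β + γ, β / (β + γ)), ⟨⟨hp, hs⟩, div_pos hβ hp, ?_⟩, ?_⟩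
    · rw [div_lt_one hp]; linarith
    · have : (β + γ) * (β / (β + γ)) = β := by field_simp
      simp only [duffy, smul_add, smul_smul, this]
      module

lemma eq_of_smul_add_smul_eq {a b : ℝ × ℝ} (hD : det2 a b ≠ 0) {β γ β' γ' : ℝ}
    (h : β • a + γ • b = β' • a + γ' • b) : β = β' ∧ γ = γ' := by
  have h1 := congrArg Prod.fst h
  have h2 := congrArg Prod.snd h
  simp only [Prod.fst_add, Prod.snd_add, Prod.smul_fst, Prod.smul_snd, smul_eq_mul] at h1 h2
  constructor
  · refine mul_right_cancel₀ hD ?_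
    simp only [det2]; linear_combination b.2 * h1 - b.1 * h2
  · refine mul_right_cancel₀ hD ?_
    simp only [det2]; linear_combination a.1 * h2 - a.2 * h1

lemma duffy_injOn {z a b : ℝ × ℝ} (hD : det2 a b ≠ 0) :
    Set.InjOn (duffy z a b) (Set.Ioo 0 1 ×ˢ Set.Ioo 0 1) := by
  rintro ⟨r, s⟩ ⟨⟨hr0, hr1⟩, hs0, hs1⟩ ⟨r', s'⟩ ⟨⟨hr0', hr1'⟩, hs0', hs1'⟩ heq
  simp only [duffy, add_right_inj] at heq
  simp only at hr0
  obtain ⟨h1, h2⟩ := eq_of_smul_add_smul_eq hD (β := r * s) (γ := r * (1 - s))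
    (β' := r' * s') (γ' := r' * (1 - s')) (by
      calc _ = r • (b + s • (a - b)) := by module
        _ = _ := heq
        _ = _ := by module)
  have h3 : r = r' := by linarith
  subst h3
  have h4 : s = s' := mul_left_cancel₀ hr0.ne' h1
  rw [h4]

lemma setIntegral_tri {z A B : ℝ × ℝ} (h : AffineIndependent ℝ ![z, A, B]) (F : ℝ × ℝ → ℝ) :
    ∫ p in tri z A B, F p = |det2 (A - z) (B - z)| *
      ∫ x in Set.Ioo (0 : ℝ) 1 ×ˢ Set.Ioo (0 : ℝ) 1, x.1 * F (duffy z (A - z) (B - z) x) := by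
  have hm : MeasurableSet (Set.Ioo (0 : ℝ) 1 ×ˢ Set.Ioo (0 : ℝ) 1) :=
    measurableSet_Ioo.prod measurableSet_Ioo
  rw [← duffy_image h, integral_image_eq_integral_abs_det_fderiv_smul volume hm
    (fun x _ => (hasFDerivAt_duffy z (A - z) (B - z) x).hasFDerivWithinAt)
    (duffy_injOn (det2_ne_zero_of_affineIndependent h)), ← integral_const_mul]
  refine setIntegral_congr_fun hm fun x hx => ?_
  simp only [det_duffyDeriv, abs_neg, abs_mul, abs_of_pos hx.1.1, smul_eq_mul]
  ring

lemma integral_Ioo_eq_unitIntegral (p : Polynomial ℝ) :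
    ∫ x in Set.Ioo (0 : ℝ) 1, p.eval x = unitIntegral p := by
  rw [unitIntegral_apply, intervalIntegral.integral_of_le zero_le_one, integral_Ioc_eq_integral_Ioo]

/-- The barycentric coordinate function along the first edge, as a bivariate polynomial. -/
def edgeCoord (z a b : ℝ × ℝ) : MvPolynomial (Fin 2) ℝ :=
  MvPolynomial.C (b.2 / det2 a b) * (MvPolynomial.X 0 - MvPolynomial.C z.1)
    - MvPolynomial.C (b.1 / det2 a b) * (MvPolynomial.X 1 - MvPolynomial.C z.2)

lemma totalDegree_edgeCoord_le (z a b : ℝ × ℝ) : (edgeCoord z a b).totalDegree ≤ 1 := by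
  have : ∀ (c d : ℝ) (i : Fin 2), (MvPolynomial.C c * (MvPolynomial.X i - MvPolynomial.C d) :
      MvPolynomial (Fin 2) ℝ).totalDegree ≤ 1 := by
    intro c d i
    refine (MvPolynomial.totalDegree_mul _ _).trans ?_
    rw [MvPolynomial.totalDegree_C, zero_add]
    exact (MvPolynomial.totalDegree_sub _ _).trans (by simp)
  exact (MvPolynomial.totalDegree_sub _ _).trans (max_le (this _ _ _) (this _ _ _))

lemma evalP_edgeCoord {a b : ℝ × ℝ} (hD : det2 a b ≠ 0) (z : ℝ × ℝ) (β γ : ℝ) :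
    evalP (edgeCoord z a b) (z + (β • a + γ • b)) = β := by
  simp only [evalP, edgeCoord, map_sub, map_mul, MvPolynomial.eval_C, MvPolynomial.eval_X,
    Matrix.cons_val_zero, Matrix.cons_val_one, Prod.fst_add, Prod.snd_add, Prod.smul_fst,
    Prod.smul_snd, smul_eq_mul]
  field_simp
  simp only [det2]
  ring

/-- Test polynomials, given by `r ^ l * s ^ i` in the coordinates of the map `duffy`. -/
def testPoly (z a b : ℝ × ℝ) (i l : ℕ) : MvPolynomial (Fin 2) ℝ :=
  edgeCoord z a b ^ i * (edgeCoord z a b + edgeCoord z b a) ^ (l - i)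

lemma totalDegree_testPoly_le (z a b : ℝ × ℝ) {i l : ℕ} (hil : i ≤ l) :
    (testPoly z a b i l).totalDegree ≤ l := by
  have h1 : (edgeCoord z a b ^ i).totalDegree ≤ i * 1 :=
    (MvPolynomial.totalDegree_pow _ _).trans
      (Nat.mul_le_mul_left _ (totalDegree_edgeCoord_le z a b))
  have h2 : ((edgeCoord z a b + edgeCoord z b a) ^ (l - i)).totalDegree ≤ (l - i) * 1 :=
    (MvPolynomial.totalDegree_pow _ _).trans (Nat.mul_le_mul_left _
      ((MvPolynomial.totalDegree_add _ _).trans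
        (max_le (totalDegree_edgeCoord_le z a b) (totalDegree_edgeCoord_le z b a))))
  have := MvPolynomial.totalDegree_mul (edgeCoord z a b ^ i)
    ((edgeCoord z a b + edgeCoord z b a) ^ (l - i))
  rw [testPoly]
  omega

lemma evalP_testPoly {a b : ℝ × ℝ} (hD : det2 a b ≠ 0) (z : ℝ × ℝ) {i l : ℕ} (hil : i ≤ l)
    (x : ℝ × ℝ) : evalP (testPoly z a b i l) (duffy z a b x) = x.1 ^ l * x.2 ^ i := by
  have hD' : det2 b a ≠ 0 := by
    intro h0
    apply hD
    simp only [det2] at h0 ⊢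
    linarith
  have h1 : duffy z a b x = z + ((x.1 * x.2) • a + (x.1 * (1 - x.2)) • b) := by
    simp only [duffy]; module
  have h2 : duffy z a b x = z + ((x.1 * (1 - x.2)) • b + (x.1 * x.2) • a) := by
    simp only [duffy]; module
  have e1 : evalP (edgeCoord z a b) (duffy z a b x) = x.1 * x.2 := by
    rw [h1, evalP_edgeCoord hD]
  have e2 : evalP (edgeCoord z b a) (duffy z a b x) = x.1 * (1 - x.2) := by
    rw [h2, evalP_edgeCoord hD']
  simp only [evalP] at e1 e2
  simp only [testPoly, evalP, map_mul, map_pow, map_add, e1, e2]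
  obtain ⟨m, rfl⟩ := Nat.exists_eq_add_of_le hil
  rw [Nat.add_sub_cancel_left]
  ring

/-- The `i`-th moment polynomial of `v` in the angular variable, a polynomial in the radial
variable. -/
def momentPoly (n : ℕ) (z a b : ℝ × ℝ) (v : MvPolynomial (Fin 2) ℝ) (i : ℕ) : Polynomial ℝ :=
  ∑ j ∈ Finset.range (n + 1), Polynomial.C (unitIntegral (restrictLine (homPart z j v) b (a - b) *
    Polynomial.X ^ i * (Polynomial.X * (1 - Polynomial.X)))) * Polynomial.X ^ j

lemma innerT_testPoly {n : ℕ} {z A B : ℝ × ℝ} (h : AffineIndependent ℝ ![z, A, B])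
    {v : MvPolynomial (Fin 2) ℝ} (hv : v.totalDegree ≤ n) {i l : ℕ} (hil : i ≤ l) :
    innerT z A B v (testPoly z (A - z) (B - z) i l) = |det2 (A - z) (B - z)| *
      unitIntegral (momentPoly n z (A - z) (B - z) v i * Polynomial.X ^ l * radialWeight) := by
  have hD := det2_ne_zero_of_affineIndependent h
  set a := A - z with ha
  set b := B - z with hb
  rw [innerT, setIntegral_tri h]
  congr 1
  have hpt : ∀ x : ℝ × ℝ, x.1 * (evalP v (duffy z a b x) * evalP (testPoly z a b i l)
      (duffy z a b x) * bubble z A B (duffy z a b x)) =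
      ∑ j ∈ Finset.range (n + 1), (Polynomial.X ^ j * Polynomial.X ^ l * radialWeight).eval x.1 *
        (restrictLine (homPart z j v) b (a - b) * Polynomial.X ^ i *
          (Polynomial.X * (1 - Polynomial.X))).eval x.2 := by
    intro x
    have h1 : duffy z a b x = z + ((x.1 * x.2) • a + (x.1 * (1 - x.2)) • b) := by
      simp only [duffy]; module
    have h2 : bubble z A B (duffy z a b x) = (1 - x.1) * (x.1 * x.2) * (x.1 * (1 - x.2)) := by
      rw [h1, bubble_eq hD]; ring
    rw [evalP_testPoly hD z hil, h2, duffy, evalP_add_smul z hv, Finset.sum_mul, Finset.sum_mul,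
      Finset.mul_sum]
    refine Finset.sum_congr rfl fun j _ => ?_
    simp only [Polynomial.eval_mul, eval_restrictLine, radialWeight, Polynomial.eval_pow,
      Polynomial.eval_X, Polynomial.eval_sub, Polynomial.eval_one]
    ring
  simp only [← ha, ← hb, hpt]
  rw [integral_finsetSum]
  · simp only [Measure.volume_eq_prod]
    rw [momentPoly, Finset.sum_mul, Finset.sum_mul, map_sum]
    refine Finset.sum_congr rfl fun j _ => ?_
    refine (setIntegral_prod_mul (μ := volume) (ν := volume)
      (fun r => (Polynomial.X ^ j * Polynomial.X ^ l * radialWeight).eval r)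
      (fun s => (restrictLine (homPart z j v) b (a - b) * Polynomial.X ^ i *
          (Polynomial.X * (1 - Polynomial.X))).eval s) (Set.Ioo 0 1) (Set.Ioo 0 1)).trans ?_
    rw [integral_Ioo_eq_unitIntegral, integral_Ioo_eq_unitIntegral, mul_assoc (Polynomial.C _),
      mul_assoc (Polynomial.C _), ← Polynomial.smul_eq_C_mul, map_smul, smul_eq_mul, mul_comm]
  · intro j _
    refine IntegrableOn.mono_set (t := Set.Icc 0 1 ×ˢ Set.Icc 0 1) ?_
      (Set.prod_mono Set.Ioo_subset_Icc_self Set.Ioo_subset_Icc_self)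
    exact ContinuousOn.integrableOn_compact (isCompact_Icc.prod isCompact_Icc)
      (by fun_prop)

lemma natDegree_momentPoly_le (n : ℕ) (z a b : ℝ × ℝ) (v : MvPolynomial (Fin 2) ℝ) (i : ℕ) :
    (momentPoly n z a b v i).natDegree ≤ n :=
  Polynomial.natDegree_sum_le_of_forall_le _ _ fun j hj =>
    (Polynomial.natDegree_C_mul_X_pow_le _ j).trans (by simp at hj; omega)

lemma coeff_momentPoly {n j : ℕ} (hj : j ≤ n) (z a b : ℝ × ℝ) (v : MvPolynomial (Fin 2) ℝ)
    (i : ℕ) : (momentPoly n z a b v i).coeff j = unitIntegral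
      (restrictLine (homPart z j v) b (a - b) * Polynomial.X ^ i *
        (Polynomial.X * (1 - Polynomial.X))) := by
  rw [momentPoly, Polynomial.finsetSum_coeff]
  simp only [Polynomial.coeff_C_mul_X_pow]
  rw [Finset.sum_ite_eq, if_pos (by simp; omega)]

lemma unitIntegral_affine (α β : ℝ) :
    unitIntegral ((Polynomial.C α + Polynomial.C β * Polynomial.X) *
      (Polynomial.X * (1 - Polynomial.X))) = α / 6 + β / 12 := by
  have : (Polynomial.C α + Polynomial.C β * Polynomial.X) *
      (Polynomial.X * (1 - Polynomial.X)) =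
      (Polynomial.C (α / 2) * Polynomial.X ^ 2 + Polynomial.C ((β - α) / 3) * Polynomial.X ^ 3
        - Polynomial.C (β / 4) * Polynomial.X ^ 4).derivative := by
    apply Polynomial.funext
    intro r
    simp
    ring
  rw [this, unitIntegral_derivative]
  simp
  ring

namespace MvPolynomial.IsHomogeneous

variable {H : MvPolynomial (Fin 2) ℝ}

lemma restrictLine_eq_of_degree_zero (hH : H.IsHomogeneous 0) (a b : ℝ × ℝ) :
    restrictLine H a b = Polynomial.C (evalP H 0) := by
  apply Polynomial.funext
  intro r
  have := hH.evalP_smul 0 (a + r • b)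
  rw [zero_smul, pow_zero, one_mul] at this
  rw [eval_restrictLine, Polynomial.eval_C, this]

lemma restrictLine_eq_of_degree_one (hH : H.IsHomogeneous 1) (a b : ℝ × ℝ) :
    restrictLine H b (a - b) = Polynomial.C (evalP H b) +
      Polynomial.C (evalP H a - evalP H b) * Polynomial.X := by
  have h := Polynomial.eq_X_add_C_of_natDegree_le_one
    (natDegree_restrictLine_le hH.totalDegree_le b (a - b))
  have h0 := eval_restrictLine H b (a - b) 0
  have h1 := eval_restrictLine H b (a - b) 1
  rw [zero_smul, add_zero] at h0
  rw [one_smul, add_sub_cancel] at h1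
  rw [h] at h0 h1
  simp only [Polynomial.eval_add, Polynomial.eval_mul, Polynomial.eval_C, Polynomial.eval_X,
    mul_zero, zero_add, mul_one] at h0 h1
  rw [h, ← h1, ← h0]
  ring_nf

lemma evalP_lineMap (hH : H.IsHomogeneous 1) (a b : ℝ × ℝ) (s : ℝ) :
    evalP H (b + s • (a - b)) = evalP H b + s * (evalP H a - evalP H b) := by
  rw [← eval_restrictLine, hH.restrictLine_eq_of_degree_one]
  simp [mul_comm]

lemma evalP_add_of_degree_one (hH : H.IsHomogeneous 1) (a b : ℝ × ℝ) :
    evalP H (a + b) = evalP H a + evalP H b := by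
  have h1 := hH.evalP_smul 2 (b + (1 / 2 : ℝ) • (a - b))
  rw [hH.evalP_lineMap] at h1
  have : (2 : ℝ) • (b + (1 / 2 : ℝ) • (a - b)) = a + b := by module
  rw [this] at h1
  rw [h1]
  ring

end MvPolynomial.IsHomogeneous

namespace TrianglePatch

variable {q : ℕ} (T : TrianglePatch q)

/-- The vector from the centre to the point dividing the outer edge of the `i`-th triangle in
ratio `s`. -/
def ray (i : ZMod q) (s : ℝ) : ℝ × ℝ :=
  (T.A i - T.z) + s • ((T.A (i - 1) - T.z) - (T.A i - T.z))

lemma add_smul_ray_mem (i : ZMod q) {s r : ℝ} (hs : s ∈ Set.Ioo (0 : ℝ) 1) (hr : 0 < r)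
    (hr1 : r < 1) : T.z + r • T.ray i s ∈ tri T.z (T.A (i - 1)) (T.A i) := by
  rw [mem_tri_iff (T.indep i)]
  refine ⟨r * s, r * (1 - s), mul_pos hr hs.1, mul_pos hr (by linarith [hs.2]), by linarith, ?_⟩
  simp only [ray]
  module

lemma eq_of_ray_eq_smul_ray {i j : ZMod q} {s s' t : ℝ} (hs : s ∈ Set.Ioo (0 : ℝ) 1)
    (hs' : s' ∈ Set.Ioo (0 : ℝ) 1) (ht : 0 < t) (h : T.ray i s = t • T.ray j s') :
    i = j ∧ s = s' := by
  have hij : i = j := by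
    by_contra hne
    have h1 := T.add_smul_ray_mem i hs (r := 1 / (2 * (1 + t))) (by positivity) (by
      rw [div_lt_one (by positivity)]; linarith)
    have h2 := T.add_smul_ray_mem j hs' (r := 1 / (2 * (1 + t)) * t) (by positivity) (by
      rw [div_mul_eq_mul_div, div_lt_one (by positivity)]; linarith)
    rw [h, smul_smul] at h1
    exact Set.disjoint_left.1 (T.disj hne) h1 h2
  subst hij
  have e : s • (T.A (i - 1) - T.z) + (1 - s) • (T.A i - T.z)
      = (t * s') • (T.A (i - 1) - T.z) + (t * (1 - s')) • (T.A i - T.z) := by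
    simp only [ray] at h
    calc _ = T.A i - T.z + s • (T.A (i - 1) - T.z - (T.A i - T.z)) := by module
      _ = _ := by rw [h]; module
  obtain ⟨e1, e2⟩ := eq_of_smul_add_smul_eq (det2_ne_zero_of_affineIndependent (T.indep i)) e
  have : t = 1 := by linarith
  exact ⟨rfl, by rw [e1, this, one_mul]⟩

lemma ray_ne_zero (i : ZMod q) {s : ℝ} (hs : s ∈ Set.Ioo (0 : ℝ) 1) : T.ray i s ≠ 0 := by
  intro h
  have h1 : (1 / 2 : ℝ) ∈ Set.Ioo (0 : ℝ) 1 := by norm_num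
  have h2 := T.eq_of_ray_eq_smul_ray (i := i) (j := i) hs hs zero_lt_two (by rw [h, smul_zero])
  have e : s • (T.A (i - 1) - T.z) + (1 - s) • (T.A i - T.z)
      = (0 : ℝ) • (T.A (i - 1) - T.z) + (0 : ℝ) • (T.A i - T.z) := by
    simp only [ray] at h
    calc _ = T.A i - T.z + s • (T.A (i - 1) - T.z - (T.A i - T.z)) := by module
      _ = _ := by rw [h]; module
  exact hs.1.ne' (eq_of_smul_add_smul_eq (det2_ne_zero_of_affineIndependent (T.indep i)) e).1

lemma eq_zero_of_three_sectors {H : MvPolynomial (Fin 2) ℝ} {k : ℕ} (hk : 1 ≤ k)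
    (hH : H.IsHomogeneous k) {I : Finset (ZMod q)} (hI : I.card = 3)
    (h : ∀ i ∈ I, ∃ R : Finset ℝ, R.card = k ∧
      ∀ r ∈ R, r ∈ Set.Ioo (0 : ℝ) 1 ∧ evalP H (T.ray i r) = 0) : H = 0 := by
  choose! R hR hroot using h
  refine hH.eq_zero_of_rays (I.sigma R) (fun x => T.ray x.1 x.2) ?_ ?_ ?_ ?_
  · rintro ⟨i, r⟩ hx
    rw [Finset.mem_sigma] at hx
    exact T.ray_ne_zero i (hroot i hx.1 r hx.2).1
  · rintro ⟨i, r⟩ hx ⟨j, s⟩ hy t ht he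
    rw [Finset.mem_sigma] at hx hy
    obtain ⟨rfl, h2⟩ := T.eq_of_ray_eq_smul_ray (hroot i hx.1 r hx.2).1
      (hroot j hy.1 s hy.2).1 ht he
    rw [h2]
  · rintro ⟨i, r⟩ hx
    rw [Finset.mem_sigma] at hx
    exact (hroot i hx.1 r hx.2).2
  · rw [Finset.card_sigma, Finset.sum_congr rfl hR, Finset.sum_const, hI]
    simp only [smul_eq_mul]
    omega

lemma card_three_consecutive {q : ℕ} (hq : 3 ≤ q) (j : ZMod q) :
    ({j + 1, j + 2, j + 3} : Finset (ZMod q)).card = 3 := by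
  have h1 : (1 : ZMod q) ≠ 0 := by
    have := (ZMod.natCast_eq_zero_iff 1 q).not.2 (fun h => by
      have := Nat.le_of_dvd one_pos h; omega)
    simpa using this
  have h2 : (2 : ZMod q) ≠ 0 := by
    have := (ZMod.natCast_eq_zero_iff 2 q).not.2 (fun h => by
      have := Nat.le_of_dvd two_pos h; omega)
    simpa using this
  rw [Finset.card_eq_three]
  refine ⟨_, _, _, ?_, ?_, ?_, rfl⟩
  · intro h; apply h1; linear_combination -h
  · intro h; apply h2; linear_combination -h
  · intro h; apply h1; linear_combination -h

lemma exists_evalP_neg {L : MvPolynomial (Fin 2) ℝ} (hL : L.IsHomogeneous 1)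
    {i : ZMod q} (hi : evalP L (T.A i - T.z) ≠ 0) : ∃ j, evalP L (T.A j - T.z) < 0 := by
  by_contra! hnn
  obtain ⟨ε, hε, hcov⟩ := T.covers
  have h0 : evalP L 0 = 0 := by
    have := hL.evalP_smul 0 0
    simpa using this
  have hball : ∀ p ∈ Metric.ball T.z ε, 0 ≤ evalP L (p - T.z) := by
    intro p hp
    obtain ⟨j, hj⟩ := Set.mem_iUnion.1 (hcov hp)
    have hconv : Convex ℝ {p : ℝ × ℝ | 0 ≤ evalP L (p - T.z)} := by
      intro x hx y hy a b ha hb hab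
      simp only [Set.mem_ofPred_eq] at hx hy ⊢
      have : a • x + b • y - T.z = a • (x - T.z) + b • (y - T.z) := by
        have hz : T.z = (a + b) • T.z := by rw [hab, one_smul]
        conv_lhs => rw [hz]
        module
      rw [this, hL.evalP_add_of_degree_one, hL.evalP_smul, hL.evalP_smul, pow_one, pow_one]
      positivity
    refine convexHull_min ?_ hconv (closure_tri_subset _ _ _ hj)
    rintro x (rfl | rfl | rfl)
    · simp [h0]
    · exact hnn _
    · exact hnn _
  have hlim : ∀ a : ℝ × ℝ, 0 ≤ evalP L a := by
    intro a
    have hpos : 0 < ε / (2 * (1 + ‖a‖)) := by positivity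
    have := hball (T.z + (ε / (2 * (1 + ‖a‖))) • a) (by
      rw [Metric.mem_ball, dist_eq_norm, add_sub_cancel_left, norm_smul, Real.norm_of_nonneg hpos.le,
        div_mul_eq_mul_div, div_lt_iff₀ (by positivity)]
      nlinarith [norm_nonneg a])
    rw [add_sub_cancel_left, hL.evalP_smul, pow_one] at this
    exact nonneg_of_mul_nonneg_right this hpos
  have h1 := hlim (T.A i - T.z)
  have h2 := hlim ((-1 : ℝ) • (T.A i - T.z))
  rw [hL.evalP_smul] at h2
  exact hi (by linarith)

lemma not_constant_positive_edge_sum {L : MvPolynomial (Fin 2) ℝ} (hL : L.IsHomogeneous 1)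
    {S : ℝ} (hS : 0 < S)
    (h : ∀ i, evalP L (T.A (i - 1) - T.z) + evalP L (T.A i - T.z) = S) : False := by
  obtain ⟨j, hj⟩ : ∃ j, evalP L (T.A j - T.z) < 0 := by
    by_cases h0 : evalP L (T.A 0 - T.z) = 0
    · refine T.exists_evalP_neg hL (i := 0 - 1) fun h1 => ?_
      have := h 0
      rw [h0, h1] at this
      linarith
    · exact T.exists_evalP_neg hL h0
  have e1 := h (j + 1)
  have e2 := h (j + 2)
  have e3 := h (j + 3)
  rw [show j + 1 - 1 = j by ring] at e1
  rw [show j + 2 - 1 = j + 1 by ring] at e2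
  rw [show j + 3 - 1 = j + 2 by ring] at e3
  have hroot : ∀ i, evalP L (T.A (i - 1) - T.z) * evalP L (T.A i - T.z) < 0 →
      ∃ R : Finset ℝ, R.card = 1 ∧
        ∀ r ∈ R, r ∈ Set.Ioo (0 : ℝ) 1 ∧ evalP L (T.ray i r) = 0 := by
    intro i hi
    set x := evalP L (T.A (i - 1) - T.z) with hx
    set y := evalP L (T.A i - T.z) with hy
    have hne : y - x ≠ 0 := by
      intro h
      rw [sub_eq_zero.1 h] at hi
      exact absurd hi (mul_self_nonneg x).not_gt
    refine ⟨{y / (y - x)}, Finset.card_singleton _, ?_⟩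
    intro r hr
    rw [Finset.mem_singleton] at hr
    subst hr
    have hsq : 0 < (y - x) ^ 2 := by positivity
    have f1 : y / (y - x) = (y * (y - x)) / (y - x) ^ 2 := by field_simp
    refine ⟨⟨?_, ?_⟩, ?_⟩
    · rw [f1]; apply div_pos _ hsq; nlinarith [sq_nonneg y]
    · rw [f1, div_lt_one hsq]; nlinarith [sq_nonneg x]
    · rw [ray, hL.evalP_lineMap, ← hx, ← hy]
      field_simp
      ring
  have hL0 : L = 0 := by
    refine T.eq_zero_of_three_sectors le_rfl hL (card_three_consecutive T.hq j) ?_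
    intro i hi
    apply hroot
    simp only [Finset.mem_insert, Finset.mem_singleton] at hi
    rcases hi with rfl | rfl | rfl
    · rw [show j + 1 - 1 = j by ring]; nlinarith
    · rw [show j + 2 - 1 = j + 1 by ring]; nlinarith
    · rw [show j + 3 - 1 = j + 2 by ring]; nlinarith
  rw [hL0] at hj
  simp [evalP] at hj

variable {T} {n : ℕ} {v : MvPolynomial (Fin 2) ℝ}

lemma unitIntegral_momentPoly_eq_zero (hv : v.totalDegree ≤ n)
    (horth : ∀ i : ZMod q, ∀ w : MvPolynomial (Fin 2) ℝ, w.totalDegree ≤ n - 1 →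
      innerT T.z (T.A (i - 1)) (T.A i) v w = 0) (i : ZMod q) {m l : ℕ} (hml : m ≤ l)
    (hl : l < n) : unitIntegral (momentPoly n T.z (T.A (i - 1) - T.z) (T.A i - T.z) v m *
      Polynomial.X ^ l * radialWeight) = 0 := by
  have h := horth i (testPoly T.z (T.A (i - 1) - T.z) (T.A i - T.z) m l)
    ((totalDegree_testPoly_le _ _ _ hml).trans (by omega))
  rw [innerT_testPoly (T.indep i) hv hml, mul_eq_zero, abs_eq_zero] at h
  exact h.resolve_left (det2_ne_zero_of_affineIndependent (T.indep i))

lemma homPart_zero_eq_zero (hn : 1 ≤ n) (hv : v.totalDegree ≤ n)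
    (horth : ∀ i : ZMod q, ∀ w : MvPolynomial (Fin 2) ℝ, w.totalDegree ≤ n - 1 →
      innerT T.z (T.A (i - 1)) (T.A i) v w = 0) : homPart T.z 0 v = 0 := by
  set F : ZMod q → Polynomial ℝ := fun i =>
    momentPoly n T.z (T.A (i - 1) - T.z) (T.A i - T.z) v 0 with hF
  have hdeg : ∀ i, (F i).natDegree ≤ n := fun i => natDegree_momentPoly_le _ _ _ _ _ _
  have hI : ∀ i l, l < n → unitIntegral (F i * Polynomial.X ^ l * radialWeight) = 0 :=
    fun i l hl => unitIntegral_momentPoly_eq_zero hv horth i (Nat.zero_le l) hl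
  have hc0 : ∀ i, (F i).coeff 0 = evalP (homPart T.z 0 v) 0 / 6 := by
    intro i
    rw [hF, coeff_momentPoly (Nat.zero_le n), pow_zero, mul_one,
      (homPart_isHomogeneous T.z 0 v).restrictLine_eq_of_degree_zero]
    have := unitIntegral_affine (evalP (homPart T.z 0 v) 0) 0
    simpa using this
  have hc1 : ∀ i, (F i).coeff 1 = (evalP (homPart T.z 1 v) (T.A (i - 1) - T.z) +
      evalP (homPart T.z 1 v) (T.A i - T.z)) / 12 := by
    intro i
    rw [hF, coeff_momentPoly hn, pow_zero, mul_one,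
      (homPart_isHomogeneous T.z 1 v).restrictLine_eq_of_degree_one, unitIntegral_affine]
    ring
  have heq : ∀ i, F i = F 0 := by
    intro i
    rw [← sub_eq_zero]
    refine radial_eq_zero_of_dvd (n := n) (k := 0)
      ((Polynomial.natDegree_sub_le _ _).trans (max_le (hdeg i) (hdeg 0))) ?_ ?_
    · rw [zero_add, pow_one, Polynomial.X_dvd_iff, Polynomial.coeff_sub, hc0, hc0, sub_self]
    · intro l _ hl
      rw [sub_mul, sub_mul, map_sub, hI i l hl, hI 0 l hl, sub_zero]
  have hsum : ∀ i, evalP (homPart T.z 1 v) (T.A (i - 1) - T.z) +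
      evalP (homPart T.z 1 v) (T.A i - T.z) = 12 * (F 0).coeff 1 := by
    intro i
    rw [← heq i, hc1 i]
    ring
  have hL := homPart_isHomogeneous T.z 1 v
  have hS : (F 0).coeff 1 = 0 := by
    rcases lt_trichotomy ((F 0).coeff 1) 0 with h | h | h
    · refine (T.not_constant_positive_edge_sum (S := -(12 * (F 0).coeff 1)) hL.neg
        (by linarith) fun i => ?_).elim
      rw [← hsum i]
      simp only [evalP, map_neg]
      ring
    · exact h
    · exact (T.not_constant_positive_edge_sum hL (by positivity) hsum).elim
  have hF0 : F 0 = 0 := radial_eq_zero_of_derivative hn (hdeg 0) (by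
    rw [← Polynomial.coeff_zero_eq_eval_zero, Polynomial.coeff_derivative, zero_add, hS, zero_mul])
    (hI 0)
  have hz : evalP (homPart T.z 0 v) 0 = 0 := by
    have := hc0 0
    rw [hF0, Polynomial.coeff_zero] at this
    linarith
  refine eq_zero_of_evalP_eq_zero_on_open isOpen_univ Set.univ_nonempty fun p _ => ?_
  have := (homPart_isHomogeneous T.z 0 v).evalP_smul 0 p
  rw [zero_smul, pow_zero, one_mul] at this
  rw [← this, hz]

lemma homPart_eq_zero_of_forall_lt {k : ℕ} (hk : 1 ≤ k) (hkn : k ≤ n) (hv : v.totalDegree ≤ n)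
    (horth : ∀ i : ZMod q, ∀ w : MvPolynomial (Fin 2) ℝ, w.totalDegree ≤ n - 1 →
      innerT T.z (T.A (i - 1)) (T.A i) v w = 0) (hlt : ∀ j < k, homPart T.z j v = 0) :
    homPart T.z k v = 0 := by
  refine T.eq_zero_of_three_sectors hk (homPart_isHomogeneous T.z k v)
    (card_three_consecutive T.hq 0) fun i _ => ?_
  obtain ⟨R, hR, hroot⟩ := exists_roots_of_orthogonal (k := k)
    (f := restrictLine (homPart T.z k v) (T.A i - T.z)
      ((T.A (i - 1) - T.z) - (T.A i - T.z))) (fun m hm => by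
      have hzero : momentPoly n T.z (T.A (i - 1) - T.z) (T.A i - T.z) v m = 0 := by
        refine radial_eq_zero_of_dvd (n := n) (k := k - 1) (natDegree_momentPoly_le _ _ _ _ _ _)
          ?_ fun l hl hln => unitIntegral_momentPoly_eq_zero hv horth i (by omega) hln
        rw [Polynomial.X_pow_dvd_iff]
        intro d hd
        rw [coeff_momentPoly (by omega), hlt d (by omega)]
        simp [restrictLine]
      rw [← coeff_momentPoly hkn, hzero, Polynomial.coeff_zero])
  exact ⟨R, hR, fun r hr => ⟨(hroot r hr).1, by
    rw [ray, ← eval_restrictLine]; exact (hroot r hr).2⟩⟩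

/-- A polynomial of degree at most `n` that is orthogonal to the polynomials of degree at most
`n - 1` on every triangle of a patch vanishes. -/
theorem eq_zero_of_orthogonal (hn : 1 ≤ n) (hv : v.totalDegree ≤ n)
    (horth : ∀ i : ZMod q, ∀ w : MvPolynomial (Fin 2) ℝ, w.totalDegree ≤ n - 1 →
      innerT T.z (T.A (i - 1)) (T.A i) v w = 0) : v = 0 := by
  refine eq_zero_of_homPart_eq_zero (z := T.z) hv fun j => ?_
  induction j using Nat.strong_induction_on with
  | _ j ih =>
    intro hj
    rcases Nat.eq_zero_or_pos j with rfl | hpos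
    · exact homPart_zero_eq_zero hn hv horth
    · exact homPart_eq_zero_of_forall_lt hpos hj hv horth fun m hm => ih m hm (by omega)

end TrianglePatch

lemma eqOn_zero_of_setIntegral_eq_zero {f : ℝ × ℝ → ℝ} {U : Set (ℝ × ℝ)} (hf : Continuous f)
    (hU : IsOpen U) (hI : IntegrableOn f U) (hnn : ∀ p ∈ U, 0 ≤ f p)
    (h : ∫ p in U, f p = 0) : ∀ p ∈ U, f p = 0 := by
  rw [setIntegral_eq_zero_iff_of_nonneg_ae
    ((ae_restrict_iff' hU.measurableSet).2 (Filter.Eventually.of_forall hnn)) hI] at h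
  exact Measure.eqOn_open_of_ae_eq h hU hf.continuousOn continuousOn_const

lemma bubble_pos {z A B p : ℝ × ℝ} (h : AffineIndependent ℝ ![z, A, B]) (hp : p ∈ tri z A B) :
    0 < bubble z A B p := by
  obtain ⟨β, γ, hβ, hγ, hs, rfl⟩ := (mem_tri_iff h p).1 hp
  rw [bubble_eq (det2_ne_zero_of_affineIndependent h)]
  have : 0 < 1 - β - γ := by linarith
  positivity

lemma tri_nonempty {z A B : ℝ × ℝ} (h : AffineIndependent ℝ ![z, A, B]) : (tri z A B).Nonempty :=
  ⟨_, (mem_tri_iff h _).2 ⟨1 / 3, 1 / 3, by norm_num, by norm_num, by norm_num, rfl⟩⟩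

lemma innerT_comm (A B C : ℝ × ℝ) (u v : MvPolynomial (Fin 2) ℝ) :
    innerT A B C u v = innerT A B C v u := by
  simp only [innerT, mul_comm (evalP u _)]

lemma innerT_add_left (A B C : ℝ × ℝ) (u u' v : MvPolynomial (Fin 2) ℝ) :
    innerT A B C (u + u') v = innerT A B C u v + innerT A B C u' v := by
  rw [innerT, innerT, innerT, ← integral_add (integrableOn_innerT A B C u v)
    (integrableOn_innerT A B C u' v)]
  simp only [evalP_add, add_mul]

lemma innerT_smul_left (A B C : ℝ × ℝ) (c : ℝ) (u v : MvPolynomial (Fin 2) ℝ) :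
    innerT A B C (c • u) v = c * innerT A B C u v := by
  rw [innerT, innerT, ← integral_const_mul]
  simp only [evalP_smul, mul_assoc]

lemma innerT_self_nonneg {z A B : ℝ × ℝ} (h : AffineIndependent ℝ ![z, A, B])
    (u : MvPolynomial (Fin 2) ℝ) : 0 ≤ innerT z A B u u :=
  setIntegral_nonneg (isOpen_tri _ _ _).measurableSet fun _ hp =>
    mul_nonneg (mul_self_nonneg _) (bubble_pos h hp).le

lemma eq_zero_of_innerT_self {z A B : ℝ × ℝ} (h : AffineIndependent ℝ ![z, A, B])
    {u : MvPolynomial (Fin 2) ℝ} (hu : innerT z A B u u = 0) : u = 0 := by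
  refine eq_zero_of_evalP_eq_zero_on_open (isOpen_tri z A B) (tri_nonempty h) fun p hp => ?_
  have := eqOn_zero_of_setIntegral_eq_zero
    (((continuous_evalP u).mul (continuous_evalP u)).mul (continuous_bubble z A B))
    (isOpen_tri z A B) (integrableOn_innerT z A B u u)
    (fun p hp => mul_nonneg (mul_self_nonneg _) (bubble_pos h hp).le) hu p hp
  exact mul_self_eq_zero.1 ((mul_eq_zero.1 this).resolve_right (bubble_pos h hp).ne')

section PatchInner

variable {q : ℕ} (T : TrianglePatch q) (u u' v : ZMod q → MvPolynomial (Fin 2) ℝ)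

lemma patchInner_comm : patchInner T u v = patchInner T v u := by
  simp only [patchInner]
  exact Finset.sum_congr rfl fun i _ => innerT_comm _ _ _ _ _

lemma patchInner_add_left : patchInner T (u + u') v = patchInner T u v + patchInner T u' v := by
  simp only [patchInner, ← Finset.sum_add_distrib]
  exact Finset.sum_congr rfl fun i _ => innerT_add_left _ _ _ _ _ _

lemma patchInner_smul_left (c : ℝ) : patchInner T (c • u) v = c * patchInner T u v := by
  simp only [patchInner, Finset.mul_sum]
  exact Finset.sum_congr rfl fun i _ => innerT_smul_left _ _ _ _ _ _

/-- The patch inner product as a bilinear form. -/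
def patchForm : (ZMod q → MvPolynomial (Fin 2) ℝ) →ₗ[ℝ]
    (ZMod q → MvPolynomial (Fin 2) ℝ) →ₗ[ℝ] ℝ :=
  LinearMap.mk₂ ℝ (patchInner T) (patchInner_add_left T)
    (fun c u v => patchInner_smul_left T u v c)
    (fun u v v' => by
      rw [patchInner_comm, patchInner_add_left, patchInner_comm T v, patchInner_comm T v'])
    (fun c u v => by rw [patchInner_comm, patchInner_smul_left, patchInner_comm T v, smul_eq_mul])

lemma patchForm_apply : patchForm T u v = patchInner T u v := rfl

lemma patchInner_self_nonneg : 0 ≤ patchInner T u u := by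
  simp only [patchInner]
  exact Finset.sum_nonneg fun i _ => innerT_self_nonneg (T.indep i) _

variable {T u} in
lemma eq_zero_of_patchInner_self (h : patchInner T u u = 0) : u = 0 := by
  simp only [patchInner] at h
  rw [Finset.sum_eq_zero_iff_of_nonneg fun i _ => innerT_self_nonneg (T.indep i) _] at h
  exact funext fun i => eq_zero_of_innerT_self (T.indep i) (h i (by simp))

lemma patchInner_single (i : ZMod q) (w : MvPolynomial (Fin 2) ℝ) :
    patchInner T u (Pi.single i w) = innerT T.z (T.A (i - 1)) (T.A i) (u i) w := by
  simp only [patchInner]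
  refine (Finset.sum_eq_single i (fun j _ hj => ?_) fun h => ?_).trans ?_
  · rw [Pi.single_eq_of_ne hj, innerT]
    simp [evalP]
  · simp at h
  · rw [Pi.single_eq_same]

end PatchInner

namespace TrianglePatch

variable {q : ℕ} (T : TrianglePatch q)

lemma tri_subset_Omega (i : ZMod q) : tri T.z (T.A (i - 1)) (T.A i) ⊆ T.Omega :=
  interior_maximal (subset_closure.trans
    (Set.subset_iUnion (fun i => closure (tri T.z (T.A (i - 1)) (T.A i))) i)) (isOpen_tri _ _ _)

lemma integrableOn_Omega {f : ℝ × ℝ → ℝ} (hf : Continuous f) : IntegrableOn f T.Omega := by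
  have : NeZero q := ⟨by have := T.hq; omega⟩
  refine (hf.continuousOn.integrableOn_compact (isCompact_iUnion fun i : ZMod q =>
    isCompact_convexHull_triple T.z (T.A (i - 1)) (T.A i))).mono_set ?_
  exact interior_subset.trans (Set.iUnion_mono fun i => closure_tri_subset _ _ _)

lemma integral_Omega_sq_pos {v : MvPolynomial (Fin 2) ℝ} (hv : v ≠ 0) :
    0 < ∫ p in T.Omega, (evalP v p) ^ 2 := by
  refine lt_of_le_of_ne (integral_nonneg fun p => sq_nonneg _) fun h => hv ?_
  have hz := eqOn_zero_of_setIntegral_eq_zero ((continuous_evalP v).pow 2) isOpen_interior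
    (T.integrableOn_Omega ((continuous_evalP v).pow 2)) (fun p _ => sq_nonneg _) h.symm
  exact eq_zero_of_evalP_eq_zero_on_open isOpen_interior
    ((tri_nonempty (T.indep 0)).mono (T.tri_subset_Omega 0))
    fun p hp => pow_eq_zero_iff two_ne_zero |>.1 (hz p hp)

/-- The `L²(Ω)` inner product of polynomials as a bilinear form. -/
def omegaForm : MvPolynomial (Fin 2) ℝ →ₗ[ℝ] MvPolynomial (Fin 2) ℝ →ₗ[ℝ] ℝ :=
  have hI (u v : MvPolynomial (Fin 2) ℝ) :=
    T.integrableOn_Omega ((continuous_evalP u).mul (continuous_evalP v))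
  LinearMap.mk₂ ℝ (fun u v => ∫ p in T.Omega, evalP u p * evalP v p)
    (fun u u' v => by
      simp only [evalP_add, add_mul]
      exact integral_add (hI u v) (hI u' v))
    (fun c u v => by
      simp only [evalP_smul, mul_assoc, smul_eq_mul]
      exact integral_const_mul _ _)
    (fun u v v' => by
      simp only [evalP_add, mul_add]
      exact integral_add (hI u v) (hI u v'))
    (fun c u v => by
      simp only [evalP_smul, mul_left_comm _ c, smul_eq_mul]
      exact integral_const_mul _ _)

lemma omegaForm_self (v : MvPolynomial (Fin 2) ℝ) :
    T.omegaForm v v = ∫ p in T.Omega, (evalP v p) ^ 2 := by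
  simp only [omegaForm, LinearMap.mk₂_apply, sq]

end TrianglePatch

/-- On a finite-dimensional space a positive definite bilinear form dominates a positive multiple
of any other bilinear form. -/
lemma exists_pos_mul_le_of_posDef {V : Type*} [AddCommGroup V] [Module ℝ V]
    [FiniteDimensional ℝ V] (B₁ B₂ : V →ₗ[ℝ] V →ₗ[ℝ] ℝ) (h : ∀ v, v ≠ 0 → 0 < B₁ v v) :
    ∃ c > 0, ∀ v, c * B₂ v v ≤ B₁ v v := by
  let e := (Module.finBasis ℝ V).equivFun
  have hcont (B : V →ₗ[ℝ] V →ₗ[ℝ] ℝ) :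
      Continuous fun x : Fin (Module.finrank ℝ V) → ℝ => B (e.symm x) (e.symm x) := by
    let L : (Fin (Module.finrank ℝ V) → ℝ) →ₗ[ℝ] (Fin (Module.finrank ℝ V) → ℝ) →L[ℝ] ℝ :=
      LinearMap.toContinuousLinearMap.toLinearMap ∘ₗ (B.compl₁₂ e.symm.toLinearMap
        e.symm.toLinearMap)
    have hL : Continuous L := L.continuous_of_finiteDimensional
    exact hL.clm_apply continuous_id
  have hpos : ∀ x ∈ Metric.sphere (0 : Fin (Module.finrank ℝ V) → ℝ) 1,
      0 < B₁ (e.symm x) (e.symm x) := by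
    intro x hx
    refine h _ fun h0 => ?_
    rw [LinearEquiv.map_eq_zero_iff] at h0
    simp [h0] at hx
  obtain ⟨C, hC⟩ := (isCompact_sphere (0 : Fin (Module.finrank ℝ V) → ℝ) 1).bddAbove_image
    ((hcont B₂).continuousOn.div (hcont B₁).continuousOn fun x hx => (hpos x hx).ne')
  have hC1 : 0 < max C 1 := lt_max_of_lt_right one_pos
  refine ⟨(max C 1)⁻¹, inv_pos.2 hC1, fun v => ?_⟩
  by_cases hv : v = 0
  · simp [hv]
  have hev : e v ≠ 0 := by simpa using hv
  have hn : 0 < ‖e v‖ := norm_pos_iff.2 hev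
  have hx : ‖e v‖⁻¹ • e v ∈ Metric.sphere (0 : Fin (Module.finrank ℝ V) → ℝ) 1 := by
    rw [mem_sphere_zero_iff_norm, norm_smul, norm_inv, norm_norm, inv_mul_cancel₀ hn.ne']
  have h1 := hC (Set.mem_image_of_mem _ hx)
  simp only [Pi.div_apply, map_smul, LinearEquiv.symm_apply_apply, LinearMap.smul_apply,
    smul_eq_mul] at h1
  rw [mul_div_mul_left _ _ (inv_ne_zero hn.ne'), mul_div_mul_left _ _ (inv_ne_zero hn.ne'),
    div_le_iff₀ (h v hv)] at h1
  rw [inv_mul_le_iff₀ hC1]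
  exact h1.trans (mul_le_mul_of_nonneg_right (le_max_left _ _) (h v hv).le)

section Projection

variable {n q : ℕ} {T : TrianglePatch q}
  {proj : (ZMod q → MvPolynomial (Fin 2) ℝ) → ZMod q → MvPolynomial (Fin 2) ℝ}

lemma patchInner_eq_of_proj
    (hproj : ∀ v : ZMod q → MvPolynomial (Fin 2) ℝ, (∀ i, (v i).totalDegree ≤ n) →
      ∀ w : ZMod q → MvPolynomial (Fin 2) ℝ, (∀ i, (w i).totalDegree ≤ n - 1) →
        patchInner T (fun i => v i - proj v i) w = 0)
    {v w : ZMod q → MvPolynomial (Fin 2) ℝ} (hv : ∀ i, (v i).totalDegree ≤ n)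
    (hw : ∀ i, (w i).totalDegree ≤ n - 1) : patchInner T v w = patchInner T (proj v) w := by
  have h : patchForm T (v - proj v) w = 0 := hproj v hv w hw
  rw [map_sub, LinearMap.sub_apply, sub_eq_zero] at h
  exact h

lemma eq_zero_of_proj_eq_zero (hn : 1 ≤ n)
    (hproj : ∀ v : ZMod q → MvPolynomial (Fin 2) ℝ, (∀ i, (v i).totalDegree ≤ n) →
      ∀ w : ZMod q → MvPolynomial (Fin 2) ℝ, (∀ i, (w i).totalDegree ≤ n - 1) →
        patchInner T (fun i => v i - proj v i) w = 0)
    {v : MvPolynomial (Fin 2) ℝ} (hv : v.totalDegree ≤ n) (h : (proj fun _ => v) = 0) :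
    v = 0 := by
  refine TrianglePatch.eq_zero_of_orthogonal (T := T) hn hv fun i w hw => ?_
  rw [← patchInner_single T (fun _ => v) i w, patchInner_eq_of_proj hproj (fun _ => hv), h,
    ← patchForm_apply, map_zero, LinearMap.zero_apply]
  intro j
  by_cases hj : j = i
  · subst hj; rwa [Pi.single_eq_same]
  · simp [Pi.single_eq_of_ne hj]

end Projection

lemma exists_pos_mul_omega_le {q : ℕ} (n : ℕ) (T : TrianglePatch q) :
    ∃ c > 0, ∀ v : MvPolynomial (Fin 2) ℝ, v.totalDegree ≤ n →
      c * ∫ p in T.Omega, (evalP v p) ^ 2 ≤ patchInner T (fun _ => v) (fun _ => v) := by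
  let V := MvPolynomial.restrictTotalDegree (Fin 2) ℝ n
  let ι : V →ₗ[ℝ] ZMod q → MvPolynomial (Fin 2) ℝ := LinearMap.pi fun _ => V.subtype
  obtain ⟨c, hc, h⟩ := exists_pos_mul_le_of_posDef ((patchForm T).compl₁₂ ι ι)
    (T.omegaForm.compl₁₂ V.subtype V.subtype) fun v hv => by
      refine lt_of_le_of_ne (patchInner_self_nonneg T _) fun h0 => hv ?_
      exact Subtype.ext (congrFun (eq_zero_of_patchInner_self h0.symm) 0)
  refine ⟨c, hc, fun v hv => ?_⟩
  rw [← T.omegaForm_self]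
  exact h ⟨v, (MvPolynomial.mem_restrictTotalDegree _ _ _).2 hv⟩

lemma exists_pos_mul_patchInner_le {n q : ℕ} (hn : 1 ≤ n) (T : TrianglePatch q)
    (proj : (ZMod q → MvPolynomial (Fin 2) ℝ) → ZMod q → MvPolynomial (Fin 2) ℝ)
    (hdeg : ∀ v : ZMod q → MvPolynomial (Fin 2) ℝ,
      (∀ i, (v i).totalDegree ≤ n) → ∀ i, (proj v i).totalDegree ≤ n - 1)
    (hproj : ∀ v : ZMod q → MvPolynomial (Fin 2) ℝ, (∀ i, (v i).totalDegree ≤ n) →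
      ∀ w : ZMod q → MvPolynomial (Fin 2) ℝ, (∀ i, (w i).totalDegree ≤ n - 1) →
        patchInner T (fun i => v i - proj v i) w = 0) :
    ∃ c > 0, ∀ v : MvPolynomial (Fin 2) ℝ, v.totalDegree ≤ n →
      c * patchInner T (fun _ => v) (fun _ => v) ≤
        patchInner T (proj fun _ => v) (proj fun _ => v) := by
  let V := MvPolynomial.restrictTotalDegree (Fin 2) ℝ n
  let ι : V →ₗ[ℝ] ZMod q → MvPolynomial (Fin 2) ℝ := LinearMap.pi fun _ => V.subtype
  have hι : ∀ v i, (ι v i).totalDegree ≤ n := fun v _ =>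
    (MvPolynomial.mem_restrictTotalDegree _ _ _).1 v.2
  have heq : ∀ v w : V, patchForm T (ι v) (proj (ι w)) = patchForm T (proj (ι v)) (proj (ι w)) :=
    fun v w => patchInner_eq_of_proj hproj (hι v) (hdeg _ (hι w))
  have hsymm : ∀ v w : V, patchForm T (ι v) (proj (ι w)) = patchForm T (ι w) (proj (ι v)) := by
    intro v w
    rw [heq, heq]
    exact patchInner_comm T _ _
  let B : V →ₗ[ℝ] V →ₗ[ℝ] ℝ := LinearMap.mk₂ ℝ (fun v w => patchForm T (ι v) (proj (ι w)))
    (fun v v' w => by simp only [map_add, LinearMap.add_apply])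
    (fun a v w => by simp only [map_smul, LinearMap.smul_apply])
    (fun v w w' => by
      rw [hsymm, hsymm v w, hsymm v w']
      simp only [map_add, LinearMap.add_apply])
    (fun a v w => by
      rw [hsymm, hsymm v w]
      simp only [map_smul, LinearMap.smul_apply])
  obtain ⟨c, hc, h⟩ := exists_pos_mul_le_of_posDef B ((patchForm T).compl₁₂ ι ι) fun v hv => by
    refine (lt_of_le_of_ne (patchInner_self_nonneg T (proj (ι v))) fun h0 => hv ?_).trans_eq
      (heq v v).symm
    exact Subtype.ext (eq_zero_of_proj_eq_zero hn hproj (hι v 0)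
      (eq_zero_of_patchInner_self h0.symm))
  refine ⟨c, hc, fun v hv => ?_⟩
  let w : V := ⟨v, (MvPolynomial.mem_restrictTotalDegree _ _ _).2 hv⟩
  exact (h w).trans_eq (heq w w)

/-- Let `n ≥ 1`, let `𝒯` be a triangle patch and `proj` the
`(·,·)_𝒯`-orthogonal projection of the piecewise polynomials of degree `≤ n` onto those of
degree `≤ n-1` (hypotheses `hdeg`, `hproj`).  Then `c_n'(𝒯) > 0`, `c_n''(𝒯) > 0`, and
`ĉ_n(𝒯) ≥ c_n''(𝒯) · c_n'(𝒯) > 0`. -/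
theorem statement18 (n q : ℕ) (hn : 1 ≤ n) (T : TrianglePatch q)
    (proj : (ZMod q → MvPolynomial (Fin 2) ℝ) → ZMod q → MvPolynomial (Fin 2) ℝ)
    (hdeg : ∀ v : ZMod q → MvPolynomial (Fin 2) ℝ,
      (∀ i, (v i).totalDegree ≤ n) → ∀ i, (proj v i).totalDegree ≤ n - 1)
    (hproj : ∀ v : ZMod q → MvPolynomial (Fin 2) ℝ, (∀ i, (v i).totalDegree ≤ n) →
      ∀ w : ZMod q → MvPolynomial (Fin 2) ℝ, (∀ i, (w i).totalDegree ≤ n - 1) →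
        patchInner T (fun i => v i - proj v i) w = 0) :
    0 < sInf (cPrimeSet n q T proj) ∧
    0 < sInf (cDoubleSet n q T) ∧
    sInf (cHatSet n q T proj) ≥ sInf (cDoubleSet n q T) * sInf (cPrimeSet n q T proj) ∧
    0 < sInf (cDoubleSet n q T) * sInf (cPrimeSet n q T proj) := by
  obtain ⟨c, hc, hcle⟩ := exists_pos_mul_patchInner_le hn T proj hdeg hproj
  obtain ⟨d, hd, hdle⟩ := exists_pos_mul_omega_le n T
  have hpos : ∀ v : MvPolynomial (Fin 2) ℝ, v ≠ 0 → 0 < patchInner T (fun _ => v) (fun _ => v) :=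
    fun v hv => lt_of_le_of_ne (patchInner_self_nonneg T _) fun h =>
      hv (congrFun (eq_zero_of_patchInner_self h.symm) 0)
  have hone : (1 : MvPolynomial (Fin 2) ℝ) ≠ 0 ∧
      (1 : MvPolynomial (Fin 2) ℝ).totalDegree ≤ n := ⟨one_ne_zero, by simp⟩
  have hc' : ∀ r ∈ cPrimeSet n q T proj, c ≤ r := by
    rintro r ⟨v, hv, hvn, rfl⟩
    rw [le_div_iff₀ (hpos v hv)]
    exact hcle v hvn
  have hd' : ∀ r ∈ cDoubleSet n q T, d ≤ r := by
    rintro r ⟨v, hv, hvn, rfl⟩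
    rw [le_div_iff₀ (T.integral_Omega_sq_pos hv)]
    exact hdle v hvn
  have h1 : 0 < sInf (cPrimeSet n q T proj) :=
    hc.trans_le (le_csInf ⟨_, 1, hone.1, hone.2, rfl⟩ hc')
  have h2 : 0 < sInf (cDoubleSet n q T) :=
    hd.trans_le (le_csInf ⟨_, 1, hone.1, hone.2, rfl⟩ hd')
  refine ⟨h1, h2, le_csInf ⟨_, 1, hone.1, hone.2, rfl⟩ ?_, mul_pos h2 h1⟩
  rintro r ⟨v, hv, hvn, rfl⟩
  have e1 : sInf (cPrimeSet n q T proj) ≤ _ := csInf_le ⟨c, hc'⟩ ⟨v, hv, hvn, rfl⟩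
  have e2 : sInf (cDoubleSet n q T) ≤ _ := csInf_le ⟨d, hd'⟩ ⟨v, hv, hvn, rfl⟩
  rw [patchInner_eq_of_proj hproj (fun _ => hvn) (hdeg _ fun _ => hvn)]
  refine (mul_le_mul e2 e1 h1.le (h2.le.trans e2)).trans_eq ?_
  rw [div_mul_div_comm, mul_comm, mul_div_mul_right _ _ (hpos v hv).ne']
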